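/- arXiv:1805.10847 — 4 statements merged into one kernel-verified Lean document; each statement's English description precedes it below -/
import Mathlib

section
/- Let p₀, p₁, p₂, p₃ be the vertices of a convex quadrilateral listed in counter-clockwise cyclic order (every triple p_i, p_j, p_k with i < j < k is positively oriented). Then at least one pair of opposite side disks intersects: D_{p₀p₁} ∩ D_{p₂p₃} ≠ ∅ or D_{p₁p₂} ∩ D_{p₃p₀} ≠ ∅. -/
noncomputable section

/-- The Euclidean plane. -/
abbrev E2 := EuclideanSpace ℝ (Fin 2)

/-- The side disk with diameter the segment `pq`: the closed ball centered at the
midpoint of `p` and `q` with radius `dist p q / 2`. -/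
def sideDisk (p q : E2) : Set E2 := Metric.closedBall (midpoint ℝ p q) (dist p q / 2)

/-- The triple `(a, b, c)` is positively oriented (counter-clockwise):
the determinant of `(b - a, c - a)` is positive. -/
def Ccw (a b c : E2) : Prop :=
  0 < (b 0 - a 0) * (c 1 - a 1) - (b 1 - a 1) * (c 0 - a 0)

/-- `p : Fin n → E2` lists the vertices of a convex polygon in counter-clockwise
cyclic order: every triple `p i, p j, p k` with `i < j < k` is positively oriented. -/
def IsConvexPolygon {n : ℕ} (p : Fin n → E2) : Prop :=
  ∀ i j k : Fin n, i < j → j < k → Ccw (p i) (p j) (p k)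

/-- Cyclic successor in `Fin n` (i.e. `i + 1 (mod n)`). -/
def nxt {n : ℕ} (i : Fin n) : Fin n := ⟨((i : ℕ) + 1) % n, Nat.mod_lt _ i.pos⟩

/-- The `i`-th side disk of the polygon `p`: the disk with diameter the `i`-th side,
the segment from `p i` to `p (i+1)` (indices mod `n`). -/
def polyDisk {n : ℕ} (p : Fin n → E2) (i : Fin n) : Set E2 := sideDisk (p i) (p (nxt i))

/-- The interior of the `i`-th side disk of the polygon `p` (the corresponding open ball). -/
def polyBall {n : ℕ} (p : Fin n → E2) (i : Fin n) : Set E2 :=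
  Metric.ball (midpoint ℝ (p i) (p (nxt i))) (dist (p i) (p (nxt i)) / 2)

/-- The side-disk intersection graph `G(P)`: the simple graph on `Fin n` where distinct
`i, j` are adjacent iff the side disks `D_i` and `D_j` have a common point. -/
def sideDiskGraph {n : ℕ} (p : Fin n → E2) : SimpleGraph (Fin n) :=
  SimpleGraph.fromRel fun i j => (polyDisk p i ∩ polyDisk p j).Nonempty

/-- Two side disks have a common point as soon as the total length of two segments joining the
endpoints of one side to those of the other is at most the total length of the two sides. -/
theorem sideDisk_inter_nonempty {p q r s : E2}
    (h : dist q r + dist p s ≤ dist p q + dist r s) :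
    (sideDisk p q ∩ sideDisk r s).Nonempty := by
  have hmid : dist (midpoint ℝ p q) (midpoint ℝ r s) ≤ dist r s / 2 + dist p q / 2 := by
    rw [midpoint_comm p q]
    linarith [dist_midpoint_midpoint_le (V := E2) q p r s]
  obtain ⟨y, hy₁, hy₂⟩ := exists_dist_le_le (by positivity) (by positivity) hmid
  exact ⟨y, by rwa [sideDisk, Metric.mem_closedBall, dist_comm], Metric.mem_closedBall.2 hy₂⟩

/-- In any convex quadrilateral (vertices listed counter-clockwise), at least one of the
two pairs of opposite side disks intersects. -/
theorem opposite_sideDisks_intersect (p : Fin 4 → E2) (hconv : IsConvexPolygon p) :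
    (sideDisk (p 0) (p 1) ∩ sideDisk (p 2) (p 3)).Nonempty ∨
    (sideDisk (p 1) (p 2) ∩ sideDisk (p 3) (p 0)).Nonempty := by
  rcases le_total (dist (p 1) (p 2) + dist (p 0) (p 3)) (dist (p 0) (p 1) + dist (p 2) (p 3))
    with h | h
  · exact Or.inl (sideDisk_inter_nonempty h)
  · refine Or.inr (sideDisk_inter_nonempty ?_)
    rw [dist_comm (p 3) (p 0), dist_comm (p 1) (p 0)]
    linarith
end
end

section
/- The cycle graph C₄ is not side-disk realizable: for every convex quadrilateral P (vertices p : Fin 4 → ℝ² in convex position listed in counter-clockwise cyclic order), the side-disk intersection graph G(P) is not isomorphic to the cycle graph on 4 vertices (SimpleGraph.cycleGraph 4). -/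
noncomputable section

theorem sideDisk_inter_nonempty_iff (a b c d : E2) :
    (sideDisk a b ∩ sideDisk c d).Nonempty ↔
      dist (midpoint ℝ a b) (midpoint ℝ c d) ≤ dist a b / 2 + dist c d / 2 := by
  rw [← Set.not_disjoint_iff_nonempty_inter, sideDisk, sideDisk,
    disjoint_closedBall_closedBall_iff (by positivity) (by positivity), not_lt]

/-- Some pair of opposite side disks of a quadrilateral intersects: each bimedian is at most
half the sum of the two sides which it does not meet. -/
theorem opposite_sideDisk_inter_nonempty (a b c d : E2) :
    (sideDisk a b ∩ sideDisk c d).Nonempty ∨ (sideDisk b c ∩ sideDisk d a).Nonempty := by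
  simp only [sideDisk_inter_nonempty_iff]
  by_contra! h
  obtain ⟨h₁, h₂⟩ := h
  have h₃ := dist_midpoint_midpoint_le (V := E2) a b d c
  have h₄ := dist_midpoint_midpoint_le (V := E2) b c a d
  rw [midpoint_comm d c] at h₃
  rw [midpoint_comm a d] at h₄
  rw [dist_comm a d] at h₃
  rw [dist_comm b a] at h₄
  linarith

theorem left_mem_sideDisk (a b : E2) : a ∈ sideDisk a b := by
  rw [sideDisk, Metric.mem_closedBall, dist_left_midpoint, Real.norm_ofNat]
  linarith

theorem right_mem_sideDisk (a b : E2) : b ∈ sideDisk a b := by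
  rw [sideDisk, Metric.mem_closedBall, dist_right_midpoint, Real.norm_ofNat]
  linarith

theorem sideDiskGraph_adj_iff {n : ℕ} (p : Fin n → E2) (i j : Fin n) :
    (sideDiskGraph p).Adj i j ↔ i ≠ j ∧ (polyDisk p i ∩ polyDisk p j).Nonempty := by
  rw [sideDiskGraph, SimpleGraph.fromRel_adj, Set.inter_comm (polyDisk p j), or_self]

theorem sideDiskGraph_adj_nxt {n : ℕ} (p : Fin n → E2) (i : Fin n) (h : i ≠ nxt i) :
    (sideDiskGraph p).Adj i (nxt i) :=
  (sideDiskGraph_adj_iff p i (nxt i)).2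
    ⟨h, p (nxt i), right_mem_sideDisk _ _, left_mem_sideDisk _ _⟩

/-- The side-disk intersection graph of a quadrilateral has a vertex adjacent to all others. -/
theorem exists_forall_sideDiskGraph_adj (p : Fin 4 → E2) :
    ∃ i, ∀ j, j ≠ i → (sideDiskGraph p).Adj i j := by
  have h01 : (sideDiskGraph p).Adj 0 1 := sideDiskGraph_adj_nxt p 0 (by decide)
  have h12 : (sideDiskGraph p).Adj 1 2 := sideDiskGraph_adj_nxt p 1 (by decide)
  have h23 : (sideDiskGraph p).Adj 2 3 := sideDiskGraph_adj_nxt p 2 (by decide)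
  have h30 : (sideDiskGraph p).Adj 3 0 := sideDiskGraph_adj_nxt p 3 (by decide)
  rcases opposite_sideDisk_inter_nonempty (p 0) (p 1) (p 2) (p 3) with h | h
  · have h02 : (sideDiskGraph p).Adj 0 2 := (sideDiskGraph_adj_iff p 0 2).2 ⟨by decide, h⟩
    refine ⟨0, fun j hj => ?_⟩
    fin_cases j
    exacts [absurd rfl hj, h01, h02, h30.symm]
  · have h13 : (sideDiskGraph p).Adj 1 3 := (sideDiskGraph_adj_iff p 1 3).2 ⟨by decide, h⟩
    refine ⟨1, fun j hj => ?_⟩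
    fin_cases j
    exacts [h01.symm, absurd rfl hj, h12, h13]

theorem exists_not_cycleGraph_four_adj (v : Fin 4) :
    ∃ w, w ≠ v ∧ ¬ (SimpleGraph.cycleGraph 4).Adj v w := by
  revert v
  decide

/-- The cycle graph `C₄` is not side-disk realizable: for every convex quadrilateral,
the side-disk intersection graph is not isomorphic to the cycle graph on 4 vertices. -/
theorem not_C4_realizable (p : Fin 4 → E2) (hconv : IsConvexPolygon p) :
    ¬ Nonempty (sideDiskGraph p ≃g SimpleGraph.cycleGraph 4) := by
  rintro ⟨f⟩
  obtain ⟨i, hi⟩ := exists_forall_sideDiskGraph_adj p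
  obtain ⟨w, hw, hadj⟩ := exists_not_cycleGraph_four_adj (f i)
  obtain ⟨j, rfl⟩ := f.surjective w
  exact hadj (f.map_adj_iff.2 (hi j fun h => hw (congrArg f h)))
end
end

section
/- Let A, B, C be points of ℝ² forming an isosceles triangle with base AC, i.e. dist(A,B) = dist(B,C) > 0 and A ≠ C, whose angle at B satisfies π/3 ≤ ∠ABC < π. Let A' be a point on the line through A and B such that A lies strictly between A' and B, and let C' be a point on the line through B and C such that C lies strictly between B and C'. Let k ≥ 2 be an integer, and for every i ∈ {0, …, k}, let Q_i = C + (i/k) · (A − C) be the point of segment AC with dist(C, Q_i) = (i/k) · dist(A,C). Then the side disk D_{Q_i Q_{i+1}} is disjoint from the side disk D_{A A'} for every i ∈ {0, …, k−2}, and D_{Q_i Q_{i+1}} is disjoint from D_{C C'} for every i ∈ {1, …, k−1}. -/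
noncomputable section

/-- If the angle at `o` between `a` and `c` is at least `2π/3`, then the disk on the piece of the
ray `oc` between parameters `x` and `y` is disjoint from the disk on `oa`, provided the piece is at
least as far from `o` as it is long. -/
theorem sideDisk_inter_sideDisk_eq_empty {o a c : E2} {x y : ℝ} (hoc : o ≠ c)
    (hinner : inner ℝ (c - o) (a - o) ≤ -(‖c - o‖ * ‖a - o‖ / 2))
    (hxy : x ≠ y) (hle : 3 * |x - y| ≤ x + y) :
    sideDisk (o + x • (c - o)) (o + y • (c - o)) ∩ sideDisk o a = ∅ := by
  rw [← Set.disjoint_iff_inter_eq_empty]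
  apply Metric.closedBall_disjoint_closedBall
  have hu : 0 < ‖c - o‖ := norm_pos_iff.2 (sub_ne_zero.2 hoc.symm)
  have hw : 0 ≤ ‖a - o‖ := norm_nonneg _
  have hr : 0 < |x - y| := abs_pos.2 (sub_ne_zero.2 hxy)
  have hd₁ : dist (o + x • (c - o)) (o + y • (c - o)) = |x - y| * ‖c - o‖ := by
    rw [dist_add_left, dist_eq_norm, ← sub_smul, norm_smul, Real.norm_eq_abs]
  have hd₂ : dist o a = ‖a - o‖ := by rw [dist_comm, dist_eq_norm]
  have hcenter : dist (midpoint ℝ (o + x • (c - o)) (o + y • (c - o))) (midpoint ℝ o a) ^ 2 =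
      ((x + y) / 2) ^ 2 * ‖c - o‖ ^ 2 - (x + y) / 2 * inner ℝ (c - o) (a - o)
        + ‖a - o‖ ^ 2 / 4 := by
    have h : midpoint ℝ (o + x • (c - o)) (o + y • (c - o)) - midpoint ℝ o a =
        ((x + y) / 2) • (c - o) - (1 / 2 : ℝ) • (a - o) := by
      rw [midpoint_eq_smul_add, midpoint_eq_smul_add, invOf_eq_inv]
      module
    rw [dist_eq_norm, h, norm_sub_sq_real, norm_smul, norm_smul, inner_smul_left,
      inner_smul_right, mul_pow, mul_pow, Real.norm_eq_abs, Real.norm_eq_abs, sq_abs, sq_abs]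
    simp only [conj_trivial]
    ring
  refine lt_of_pow_lt_pow_left₀ 2 dist_nonneg ?_
  rw [hd₁, hd₂, hcenter]
  have h₁ := mul_le_mul_of_nonneg_left hinner (show 0 ≤ (x + y) / 2 by linarith)
  have h₂ := mul_le_mul_of_nonneg_right hle (mul_nonneg hu.le hw)
  have h₃ : (3 * |x - y|) ^ 2 * ‖c - o‖ ^ 2 ≤ (x + y) ^ 2 * ‖c - o‖ ^ 2 := by gcongr
  have h₄ : 0 < |x - y| ^ 2 * ‖c - o‖ ^ 2 := by positivity
  have h₅ : 0 ≤ |x - y| * (‖c - o‖ * ‖a - o‖) := by positivity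
  nlinarith

open EuclideanGeometry in
/-- In an isosceles triangle with apex angle at least `π/3` the base is at least as long as the
legs. -/
theorem dist_le_dist_of_pi_div_three_le_angle {a b c : E2} (hiso : dist a b = dist b c)
    (hang : Real.pi / 3 ≤ ∠ a b c) : dist a b ≤ dist a c := by
  have hcos : Real.cos (∠ a b c) ≤ 1 / 2 := by
    rw [← Real.cos_pi_div_three]
    exact Real.cos_le_cos_of_nonneg_of_le_pi (by positivity) (angle_le_pi a b c) hang
  have hlaw := law_cos a b c
  rw [dist_comm c b, ← hiso] at hlaw
  refine le_of_sq_le_sq ?_ dist_nonneg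
  nlinarith [mul_le_mul_of_nonneg_left hcos (mul_self_nonneg (dist a b))]

/-- In an isosceles triangle `a b c` whose base `ac` is at least as long as the legs, the exterior
angle at `a` is at least `2π/3`. -/
theorem inner_le_of_sbtw {a b c a' : E2} (hiso : dist a b = dist b c)
    (hle : dist a b ≤ dist a c) (ha' : Sbtw ℝ a' a b) :
    inner ℝ (c - a) (a' - a) ≤ -(‖c - a‖ * ‖a' - a‖ / 2) := by
  have hray : SameRay ℝ (a - a') (b - a) := by
    simpa using ha'.wbtw.sameRay_vsub
  have hpos : 0 < ‖b - a‖ := norm_pos_iff.2 (sub_ne_zero.2 ha'.ne_right.symm)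
  have hsmul : ‖b - a‖ • (a' - a) = -(‖a' - a‖ • (b - a)) := by
    have h := hray.norm_smul_eq
    rw [norm_sub_rev a a'] at h
    rw [h, ← smul_neg, neg_sub]
  rw [dist_comm a b, dist_comm b c, dist_eq_norm, dist_eq_norm] at hiso
  rw [dist_comm a b, dist_comm a c, dist_eq_norm, dist_eq_norm] at hle
  have hbase : 2 * inner ℝ (c - a) (b - a) = ‖c - a‖ ^ 2 := by
    have h := norm_sub_sq_real (c - a) (b - a)
    rw [sub_sub_sub_cancel_right, ← hiso] at h
    linarith
  have hscaled := congrArg (inner ℝ (c - a)) hsmul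
  rw [inner_smul_right, inner_neg_right, inner_smul_right] at hscaled
  refine le_of_mul_le_mul_left ?_ hpos
  rw [hscaled, show inner ℝ (c - a) (b - a) = ‖c - a‖ ^ 2 / 2 by linarith]
  have h := mul_le_mul_of_nonneg_left hle (mul_nonneg (norm_nonneg (c - a)) (norm_nonneg (a' - a)))
  nlinarith

open EuclideanGeometry in
/-- Lemma on an isosceles triangle `A B C` with base `AC` and apex angle at least `π/3`:
the side disks built on the `k` equal pieces of the base `AC` are disjoint from the disk
`D_{AA'}` (except possibly the piece touching `A`) and from the disk `D_{CC'}` (except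
possibly the piece touching `C`). Here `Q i = C + (i/k)•(A - C)`. -/
theorem pieces_disjoint_from_ends (A B C A' C' : E2)
    (hiso : dist A B = dist B C) (hpos : 0 < dist A B) (hAC : A ≠ C)
    (hang₁ : Real.pi / 3 ≤ ∠ A B C) (hang₂ : ∠ A B C < Real.pi)
    (hA' : Sbtw ℝ A' A B) (hC' : Sbtw ℝ B C C')
    (k : ℕ) (hk : 2 ≤ k) :
    (∀ i : ℕ, i ≤ k - 2 →
      sideDisk (C + ((i : ℝ) / k) • (A - C)) (C + (((i : ℝ) + 1) / k) • (A - C)) ∩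
        sideDisk A A' = ∅) ∧
    (∀ i : ℕ, 1 ≤ i → i ≤ k - 1 →
      sideDisk (C + ((i : ℝ) / k) • (A - C)) (C + (((i : ℝ) + 1) / k) • (A - C)) ∩
        sideDisk C C' = ∅) := by
  have hk0 : (0 : ℝ) < k := by exact_mod_cast (by omega : 0 < k)
  have hle := dist_le_dist_of_pi_div_three_le_angle hiso hang₁
  have habs (i : ℕ) : |(i : ℝ) / k - ((i : ℝ) + 1) / k| = 1 / k := by
    rw [show (i : ℝ) / k - ((i : ℝ) + 1) / k = -(1 / k) by ring, abs_neg, abs_of_pos (by positivity)]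
  have hne (i : ℕ) : (i : ℝ) / k ≠ ((i : ℝ) + 1) / k := by
    intro h
    have := habs i
    rw [h, sub_self, abs_zero] at this
    exact (one_div_pos.2 hk0).ne this
  refine ⟨fun i hi => ?_, fun i hi _ => ?_⟩
  · have hflip (t : ℝ) : C + t • (A - C) = A + (1 - t) • (C - A) := by module
    rw [hflip, hflip]
    refine sideDisk_inter_sideDisk_eq_empty hAC (inner_le_of_sbtw hiso hle hA')
      (fun h => hne i (sub_right_injective h)) ?_
    rw [sub_sub_sub_cancel_left, abs_sub_comm, habs]
    have hi' : (i : ℝ) + 2 ≤ k := by exact_mod_cast (by omega : i + 2 ≤ k)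
    have : ((i : ℝ) + 2) / k ≤ 1 := (div_le_one hk0).2 hi'
    ring_nf at this ⊢
    linarith
  · have hiso' : dist C B = dist B A := by rw [dist_comm C B, dist_comm B A, hiso]
    have hle' : dist C B ≤ dist C A := by rwa [hiso', dist_comm B A, dist_comm C A]
    refine sideDisk_inter_sideDisk_eq_empty hAC.symm (inner_le_of_sbtw hiso' hle' hC'.symm)
      (hne i) ?_
    rw [habs, ← add_div, ← mul_div_assoc]
    have : (1 : ℝ) ≤ i := by exact_mod_cast hi
    gcongr
    linarith
end
end

section
/- For every convex polygon P of n ≥ 3 sides, one can select at least ⌈n/4⌉ pairwise disjoint side disks: there exists a finite set S ⊆ Fin n with |S| ≥ ⌈n/4⌉ such that for all distinct i, j ∈ S the side disks D_i and D_j are disjoint. -/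
noncomputable section

lemma disk_separation_pos (A B κ h l : ℝ) (hA : 0 < A) (hB : 0 < B) (hκ : 0 < κ) (hAB : A * B ≤ 1)
    (hh : κ ≤ h) (hl : 0 ≤ l)
    (hlim : l * ((A + B) * (2 * κ) - (1 - A * B) * (1 - κ ^ 2)) ≤
      (A + B + h * (1 - A * B)) * (1 + κ ^ 2)) :
    0 < (B + h) ^ 2 * (1 + B ^ 2) * (1 + κ ^ 2)
      + (B + h) * ((A + B) * (1 - B ^ 2) * (1 + κ ^ 2) + l * (1 - κ ^ 2) * (1 + B ^ 2))
      - (A + B) * l * (B + κ) ^ 2 := by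
  have hQ : 0 < B + h := by linarith
  have hQ0 : 0 < B + κ := by linarith
  have hS : 0 < A + B := by linarith
  have hw : 0 ≤ 1 - A * B := by linarith
  have hG : 0 < (B + h) * (1 + B ^ 2) + (A + B) * (1 - B ^ 2) := by
    have h1 : 0 ≤ B * (1 - A * B) := mul_nonneg hB.le hw
    have h2 : 0 < h * (1 + B ^ 2) := by have := hκ.trans_le hh; positivity
    linear_combination hS + h1 + h2
  obtain ⟨E, hE⟩ : ∃ E, E = (B + h) * (1 - κ ^ 2) * (1 + B ^ 2) - (A + B) * (B + κ) ^ 2 :=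
    ⟨_, rfl⟩
  obtain ⟨N, hN⟩ : ∃ N, N = (A + B) * (2 * κ) - (1 - A * B) * (1 - κ ^ 2) := ⟨_, rfl⟩
  have hexp : (B + h) ^ 2 * (1 + B ^ 2) * (1 + κ ^ 2)
      + (B + h) * ((A + B) * (1 - B ^ 2) * (1 + κ ^ 2) + l * (1 - κ ^ 2) * (1 + B ^ 2))
      - (A + B) * l * (B + κ) ^ 2
      = (B + h) * (1 + κ ^ 2) * ((B + h) * (1 + B ^ 2) + (A + B) * (1 - B ^ 2)) + l * E := by
    rw [hE]; ring
  rw [hexp]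
  have hpos : 0 < (B + h) * (1 + κ ^ 2) *
      ((B + h) * (1 + B ^ 2) + (A + B) * (1 - B ^ 2)) :=
    mul_pos (mul_pos hQ (by positivity)) hG
  rcases le_or_gt 0 E with hE0 | hE0
  · have := mul_nonneg hl hE0
    linarith
  have hNpos : 0 < N := by
    by_contra hcon
    push Not at hcon
    apply absurd hE0
    push Not
    have hκS : 0 < κ * (A + B) := by positivity
    have hwc : 2 * (κ * (A + B)) ≤ (1 - A * B) * (1 - κ ^ 2) := by linarith
    have hc : 0 < 1 - κ ^ 2 := by
      by_contra h3
      push Not at h3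
      have := mul_nonpos_of_nonneg_of_nonpos hw h3
      linarith
    have hκB : κ * B ≤ 1 := by
      have h5 : 0 < κ * A := mul_pos hκ hA
      have h6 : 0 < κ * B := mul_pos hκ hB
      have h7 : 0 < A * B := mul_pos hA hB
      have h8 : 0 ≤ (1 - A * B) * κ ^ 2 := mul_nonneg hw (sq_nonneg κ)
      linarith
    have h6 : 0 ≤ (1 - κ ^ 2) * (1 + B ^ 2) - (A + B) * (B + κ) := by
      have h7 : 0 ≤ κ * (A + B) * (1 - κ * B) := mul_nonneg hκS.le (by linarith)
      linear_combination hwc + h7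
    have h9 : 0 ≤ (h - κ) * ((1 - κ ^ 2) * (1 + B ^ 2)) :=
      mul_nonneg (by linarith) (mul_nonneg hc.le (by positivity))
    have h10 := mul_nonneg hQ0.le h6
    rw [hE]
    linear_combination h9 + h10
  rw [← hN] at hlim
  have hD0 : 0 < B * (1 - A * B) * N + κ * (A + B) * (1 + B ^ 2) * (A + κ) :=
    add_pos_of_nonneg_of_pos (mul_nonneg (mul_nonneg hB.le hw) hNpos.le) (by positivity)
  have hD : 0 < (B + h) * ((B + h) * (1 + B ^ 2) + (A + B) * (1 - B ^ 2)) * N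
      + (A + B + h * (1 - A * B)) * E := by
    have : (B + h) * ((B + h) * (1 + B ^ 2) + (A + B) * (1 - B ^ 2)) * N
        + (A + B + h * (1 - A * B)) * E
        = (B + h) * (B * (1 - A * B) * N + κ * (A + B) * (1 + B ^ 2) * (A + κ))
          + (h - κ) * (2 * κ * (A + B) * (1 + B ^ 2) * (B + h)
            + (A + B) * (B + κ) * (1 + B ^ 2) * A) := by
      rw [hE, hN]; ring
    rw [this]
    have : 0 ≤ (h - κ) * (2 * κ * (A + B) * (1 + B ^ 2) * (B + h)
            + (A + B) * (B + κ) * (1 + B ^ 2) * A) :=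
      mul_nonneg (by linarith) (by positivity)
    have := mul_pos hQ hD0
    linarith
  have h11 := mul_le_mul_of_nonpos_right hlim hE0.le
  have h12 : 0 < N * ((B + h) * (1 + κ ^ 2) *
      ((B + h) * (1 + B ^ 2) + (A + B) * (1 - B ^ 2)) + l * E) := by
    have := mul_pos (show (0 : ℝ) < 1 + κ ^ 2 by positivity) hD
    linear_combination this + h11
  exact (pos_iff_pos_of_mul_pos h12).1 hNpos

lemma diametral_mono {E b t t' m M : ℝ} (hb : b ^ 2 ≤ E) (h : E - (t + t') * b + t * t' ≤ 0)
    (hmt : m ≤ t) (htM : t ≤ M) (hmt' : m ≤ t') (htM' : t' ≤ M) :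
    E - (m + M) * b + m * M ≤ 0 := by
  have h0 : (b - t) * (b - t') ≤ 0 := by linarith
  rcases le_total t b with hb1 | hb1
  · have hb2 : b ≤ t' ∨ b = t := by
      rcases hb1.eq_or_lt with h1 | h1
      · exact Or.inr h1.symm
      · left; by_contra h2; push Not at h2
        nlinarith [mul_pos (sub_pos.2 h1) (sub_pos.2 h2)]
    rcases hb2 with hb2 | rfl
    · nlinarith [mul_nonneg (sub_nonneg.2 hmt) (sub_nonneg.2 htM'),
        mul_nonneg (sub_nonneg.2 hb1) (sub_nonneg.2 htM'),
        mul_nonneg (sub_nonneg.2 hmt) (sub_nonneg.2 hb2)]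
    · nlinarith [mul_nonneg (sub_nonneg.2 hmt) (sub_nonneg.2 htM)]
  · have hb2 : t' ≤ b ∨ b = t := by
      rcases hb1.eq_or_lt with h1 | h1
      · exact Or.inr h1
      · left; by_contra h2; push Not at h2
        nlinarith [mul_pos (sub_pos.2 h1) (sub_pos.2 h2)]
    rcases hb2 with hb2 | rfl
    · nlinarith [mul_nonneg (sub_nonneg.2 hmt') (sub_nonneg.2 htM),
        mul_nonneg (sub_nonneg.2 hb2) (sub_nonneg.2 htM),
        mul_nonneg (sub_nonneg.2 hmt') (sub_nonneg.2 hb1)]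
    · nlinarith [mul_nonneg (sub_nonneg.2 hmt) (sub_nonneg.2 htM)]

lemma sq_dist_le_of_sq_le {x y x' y' R R' : ℝ} (hR : 0 ≤ R) (hR' : 0 ≤ R')
    (h : x ^ 2 + y ^ 2 ≤ R ^ 2) (h' : x' ^ 2 + y' ^ 2 ≤ R' ^ 2) :
    (x - x') ^ 2 + (y - y') ^ 2 ≤ (R + R') ^ 2 := by
  have h1 : (x * x' + y * y') ^ 2 ≤ (R * R') ^ 2 := by
    have h2 := mul_le_mul h h' (by positivity) (by positivity)
    nlinarith [sq_nonneg (x * y' - y * x')]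
  have h3 := (abs_le.1 (abs_le_of_sq_le_sq h1 (by positivity))).1
  nlinarith

lemma half_angle {c s : ℝ} (hcs : c ^ 2 + s ^ 2 = 1) (hs : 0 < s) :
    ∃ κ, 0 < κ ∧ κ * s = 1 - c ∧ c * (1 + κ ^ 2) = 1 - κ ^ 2 ∧ s * (1 + κ ^ 2) = 2 * κ := by
  have hc : c < 1 := by nlinarith
  have h0 : (1 - c) / s * s = 1 - c := by field_simp
  refine ⟨(1 - c) / s, div_pos (by linarith) hs, h0, ?_, ?_⟩
  · generalize (1 - c) / s = κ at h0 ⊢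
    have : s * (c * (1 + κ ^ 2)) = s * (1 - κ ^ 2) := by
      have h1 : κ * (1 + c) = s := by
        have : s * (κ * (1 + c)) = s * s := by linear_combination (1 + c) * h0 - hcs
        exact mul_left_cancel₀ hs.ne' this
      linear_combination (1 + c) * κ * h0 + (1 - c) * h1
    exact mul_left_cancel₀ hs.ne' this
  · generalize (1 - c) / s = κ at h0 ⊢
    have : s * (s * (1 + κ ^ 2)) = s * (2 * κ) := by
      linear_combination (κ * s + (1 - c)) * h0 + hcs - 2 * h0
    exact mul_left_cancel₀ hs.ne' this

lemma no_common_point {A B κ h l σ τ c s X Y : ℝ} (hA : 0 < A) (hB : 0 < B) (hκ : 0 < κ)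
    (hAB : A * B ≤ 1) (hh : κ ≤ h) (hl : 0 ≤ l)
    (hσ : σ * (1 + B ^ 2) = 1 - B ^ 2) (hτ : τ * (1 + B ^ 2) = 2 * B)
    (hc : c * (1 + κ ^ 2) = 1 - κ ^ 2) (hs : s * (1 + κ ^ 2) = 2 * κ)
    (hlim : l * ((A + B) * s - (1 - A * B) * c) ≤ A + B + h * (1 - A * B))
    (hX : (X - 1) * (X - 1 + (A + B) * τ) + (Y + B) * (Y + B + (A + B) * σ) ≤ 0)
    (hY : (X - 1) * (X - 1 + l * s) + (Y - h) * (Y - h - l * c) ≤ 0) : False := by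
  have hK : 0 < 1 + B ^ 2 := by positivity
  have hL : 0 < 1 + κ ^ 2 := by positivity
  have hστ : σ ^ 2 + τ ^ 2 = 1 := by
    have : (1 + B ^ 2) ^ 2 * (σ ^ 2 + τ ^ 2) = (1 + B ^ 2) ^ 2 * 1 := by
      linear_combination (σ * (1 + B ^ 2) + (1 - B ^ 2)) * hσ + (τ * (1 + B ^ 2) + 2 * B) * hτ
    exact mul_left_cancel₀ (by positivity) this
  have hcs : c ^ 2 + s ^ 2 = 1 := by
    have : (1 + κ ^ 2) ^ 2 * (c ^ 2 + s ^ 2) = (1 + κ ^ 2) ^ 2 * 1 := by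
      linear_combination (c * (1 + κ ^ 2) + (1 - κ ^ 2)) * hc + (s * (1 + κ ^ 2) + 2 * κ) * hs
    exact mul_left_cancel₀ (by positivity) this
  have key := disk_separation_pos A B κ h l hA hB hκ hAB hh hl (by
    have := mul_le_mul_of_nonneg_right hlim hL.le
    linear_combination this - l * (A + B) * hs + l * (1 - A * B) * hc)
  have h1 := sq_dist_le_of_sq_le (x := X - 1 + (A + B) / 2 * τ) (y := Y + B + (A + B) / 2 * σ)
    (x' := X - 1 + l / 2 * s) (y' := Y - h - l / 2 * c) (R := (A + B) / 2) (R' := l / 2)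
    (by positivity) (by positivity)
    (by linear_combination hX + (A + B) ^ 2 / 4 * hστ) (by linear_combination hY + l ^ 2 / 4 * hcs)
  have h2 : (B + h) ^ 2 + (B + h) * ((A + B) * σ + l * c)
      - (A + B) * l * ((1 + τ * s - σ * c) / 2) ≤ 0 := by
    linear_combination h1 + (-(A + B) ^ 2 / 4) * hστ - l ^ 2 / 4 * hcs
  have h3 := mul_le_mul_of_nonneg_right h2 (mul_pos hK hL).le
  apply absurd key
  push Not
  linear_combination h3 - (A + B) * (B + h) * (1 + κ ^ 2) * hσ - (B + h) * l * (1 + B ^ 2) * hc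
    + (A + B) * l / 2 * (s * (1 + κ ^ 2) * hτ + 2 * B * hs - c * (1 + κ ^ 2) * hσ
      - (1 - B ^ 2) * hc)

lemma sector_bound {A B α β : ℝ} (hA : 0 < A) (hB : 0 < B) (hAB : A * B ≤ 1)
    (h : α ^ 2 + (β + A) * (β - B) ≤ 0) : (1 - B ^ 2) * β ≤ 2 * B * (1 + α) := by
  have h1 : ((1 - B ^ 2) * (β - (B - A) / 2) - 2 * B * α) ^ 2
      ≤ ((1 + B ^ 2) * ((A + B) / 2)) ^ 2 := by
    have h2 : (β - (B - A) / 2) ^ 2 + α ^ 2 ≤ ((A + B) / 2) ^ 2 := by linarith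
    have h3 := mul_le_mul_of_nonneg_left h2 (sq_nonneg (1 + B ^ 2))
    linear_combination h3 + sq_nonneg ((1 - B ^ 2) * α + 2 * B * (β - (B - A) / 2))
  have h4 := (abs_le.1 (abs_le_of_sq_le_sq h1 (by positivity))).2
  have h5 := mul_le_mul_of_nonneg_right hAB hB.le
  linear_combination h4 + h5

/-- Half-angle parameters for a disk resting on the line with unit normal `(s, s')`,
relative to the normals `(a, a')` and `(1, 0)`. -/
lemma exists_tangent_params {a a' s s' : ℝ} (ha : a ^ 2 + a' ^ 2 = 1) (hs : s ^ 2 + s' ^ 2 = 1)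
    (has : 0 < a * s' - a' * s) (hsb : s' < 0) (hab : a' ≤ 0) :
    ∃ A B μ, 0 < A ∧ 0 < B ∧ A * B ≤ 1 ∧ 0 < μ ∧ s * (1 + B ^ 2) = 1 - B ^ 2 ∧
      (-s') * (1 + B ^ 2) = 2 * B ∧ B * (-s') = 1 - s ∧
      A * (a * s' - a' * s) = 1 - (a * s + a' * s') ∧
      (a * s + a' * s') * (1 + A ^ 2) = 1 - A ^ 2 ∧
      (a * s' - a' * s) * (1 + A ^ 2) = 2 * A ∧
      1 - a = μ * (A + B) ∧ -a' = μ * (1 - A * B) := by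
  obtain ⟨B, hB, hB1, hB2, hB3⟩ := half_angle (c := s) (s := -s') (by linarith) (by linarith)
  obtain ⟨A, hA, hA1, hA2, hA3⟩ := half_angle (c := a * s + a' * s') (s := a * s' - a' * s)
    (by linear_combination (s ^ 2 + s' ^ 2) * ha + hs) has
  have hμ : 0 < 2 * (A + B) / ((1 + A ^ 2) * (1 + B ^ 2)) := by positivity
  have e1 : 1 - a = 2 * (A + B) / ((1 + A ^ 2) * (1 + B ^ 2)) * (A + B) := by
    have hK : (1 + A ^ 2) * (1 + B ^ 2) ≠ 0 := by positivity
    rw [div_mul_eq_mul_div, eq_div_iff hK]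
    have : a = (a * s + a' * s') * s - (a * s' - a' * s) * (-s') := by
      linear_combination (-a) * hs
    calc _ = (1 + A ^ 2) * (1 + B ^ 2) - ((a * s + a' * s') * (1 + A ^ 2)) * (s * (1 + B ^ 2))
          + ((a * s' - a' * s) * (1 + A ^ 2)) * (-s' * (1 + B ^ 2)) := by
          linear_combination (-(1 + A ^ 2) * (1 + B ^ 2)) * this
      _ = _ := by rw [hA2, hA3, hB2, hB3]; ring
  have e2 : -a' = 2 * (A + B) / ((1 + A ^ 2) * (1 + B ^ 2)) * (1 - A * B) := by
    have hK : (1 + A ^ 2) * (1 + B ^ 2) ≠ 0 := by positivity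
    rw [div_mul_eq_mul_div, eq_div_iff hK]
    have : -a' = (a * s + a' * s') * (-s') + (a * s' - a' * s) * s := by
      linear_combination a' * hs
    calc _ = ((a * s + a' * s') * (1 + A ^ 2)) * (-s' * (1 + B ^ 2))
          + ((a * s' - a' * s) * (1 + A ^ 2)) * (s * (1 + B ^ 2)) := by
          linear_combination ((1 + A ^ 2) * (1 + B ^ 2)) * this
      _ = _ := by rw [hA2, hA3, hB2, hB3]; ring
  refine ⟨A, B, _, hA, hB, ?_, hμ, hB2, hB3, hB1, hA1, hA2, hA3, e1, e2⟩
  by_contra hcon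
  push Not at hcon
  have := mul_pos hμ (sub_pos.2 hcon)
  linarith

lemma lt_one_of_sq_add_sq {x y : ℝ} (h : x ^ 2 + y ^ 2 = 1) (hy : y ≠ 0) : x < 1 := by
  have : 0 < y ^ 2 := by positivity
  exact lt_of_pow_lt_pow_left₀ 2 zero_le_one (by linarith)

lemma separated_frame {a a' s s' z z' C C' D D' P P' Q Q' X X' d : ℝ}
    (ha : a ^ 2 + a' ^ 2 = 1) (hs : s ^ 2 + s' ^ 2 = 1) (hz : z ^ 2 + z' ^ 2 = 1)
    (has : 0 < a * s' - a' * s) (hsb : s' < 0) (hab : a' ≤ 0)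
    (hzz : 0 < z' ∨ 0 < z * a' - z' * a) (hd : 1 ≤ d)
    (hC : C * z + C' * z' = d) (hD : D * z + D' * z' = d) (hC1 : C ≤ 1) (hD1 : D ≤ 1)
    (hCa : C * a + C' * a' ≤ C) (hDa : D * a + D' * a' ≤ D)
    (hP : P * s + P' * s' = 1) (hQ : Q * s + Q' * s' = 1) (hP1 : P ≤ 1) (hQ1 : Q ≤ 1)
    (hPa : P * a + P' * a' ≤ 1) (hQa : Q * a + Q' * a' ≤ 1)
    (hX : (X - P) * (X - Q) + (X' - P') * (X' - Q') ≤ 0) :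
    0 < (X - C) * (X - D) + (X' - C') * (X' - D') := by
  obtain ⟨A, B, μ, hA, hB, hAB, hμ, hσ, hτ, hB1, hA1, hA2, hA3, e1, e2⟩ :=
    exists_tangent_params ha hs has hsb hab
  have bnd : ∀ x y : ℝ, x * s + y * s' = 1 → x ≤ 1 → x * a + y * a' ≤ 1 →
      -A ≤ y * s - x * s' ∧ y * s - x * s' ≤ B := by
    intro x y h1 h2 h3
    constructor
    · have : 0 ≤ (a * s' - a' * s) * (y * s - x * s' + A) := by
        linear_combination h3 - hA1 + (x * a + y * a') * hs - (a * s + a' * s') * h1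
      have := (mul_nonneg_iff_of_pos_left has).1 this
      linarith
    · have : 0 ≤ (-s') * (B - (y * s - x * s')) := by
        linear_combination h2 - hB1 + x * hs - s * h1
      have := (mul_nonneg_iff_of_pos_left (by linarith)).1 this
      linarith
  obtain ⟨hPl, hPu⟩ := bnd P P' hP hP1 hPa
  obtain ⟨hQl, hQu⟩ := bnd Q Q' hQ hQ1 hQa
  have hdisk : (X * s + X' * s' - 1) ^ 2 + (X' * s - X * s' + A) * (X' * s - X * s' - B) ≤ 0 := by
    have := diametral_mono (E := (X * s + X' * s' - 1) ^ 2 + (X' * s - X * s') ^ 2)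
      (b := X' * s - X * s') (t := P' * s - P * s') (t' := Q' * s - Q * s') (m := -A) (M := B)
      (by nlinarith [sq_nonneg (X * s + X' * s' - 1)])
      (by
        have h1 : (X * s + X' * s' - 1) ^ 2 = (X * s + X' * s' - (P * s + P' * s')) *
          (X * s + X' * s' - (Q * s + Q' * s')) := by rw [hP, hQ]; ring
        rw [h1]
        linear_combination hX + ((X - P) * (X - Q) + (X' - P') * (X' - Q')) * hs)
      hPl hPu hQl hQu
    linear_combination this
  rcases lt_or_ge 0 z' with hz' | hz'
  · obtain ⟨κ, hκ, hκ1, hκ2, hκ3⟩ := half_angle hz hz'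
    by_contra hcon
    push Not at hcon
    set h := (d - z) / z' with hh
    have hhz : h * z' = d - z := by rw [hh]; field_simp
    have hκh : κ ≤ h := by
      have : κ * z' ≤ h * z' := by linarith
      exact le_of_mul_le_mul_right this hz'
    have pt : ∀ x y : ℝ, x * z + y * z' = d → x ≤ 1 → x * a + y * a' ≤ x →
        ∃ γ, 0 ≤ γ ∧ x = 1 - γ * z' ∧ y = h + γ * z ∧
          γ * ((A + B) * z' - (1 - A * B) * z) ≤ A + B + h * (1 - A * B) := by
      intro x y h1 h2 h3
      have hγ : (1 - x) / z' * z' = 1 - x := by field_simp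
      have hx : x = 1 - (1 - x) / z' * z' := by linarith
      have hy : y = h + (1 - x) / z' * z := by
        have : z' * y = z' * (h + (1 - x) / z' * z) := by
          linear_combination h1 - hhz - z * hγ
        exact mul_left_cancel₀ hz'.ne' this
      refine ⟨(1 - x) / z', div_nonneg (by linarith) hz'.le, hx, hy, ?_⟩
      generalize (1 - x) / z' = γ at *
      have : 0 ≤ μ * ((A + B) * x + (1 - A * B) * y) := by
        linear_combination h3 + x * e1 + y * e2
      have := (mul_nonneg_iff_of_pos_left hμ).1 this
      rw [hx, hy] at this
      linear_combination this
    obtain ⟨γ, hγ, hCx, hCy, hCl⟩ := pt C C' hC hC1 hCa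
    obtain ⟨δ, hδ, hDx, hDy, hDl⟩ := pt D D' hD hD1 hDa
    refine no_common_point (A := A) (B := B) (κ := κ) (h := h) (l := max γ δ) (σ := s) (τ := -s')
      (c := z) (s := z') (X := X) (Y := X') hA hB hκ hAB hκh (le_max_of_le_left hγ) hσ hτ hκ2 hκ3
      ?_ ?_ ?_
    · rcases max_choice γ δ with h1 | h1 <;> rw [h1] <;> assumption
    · have hB2 : B * s = -s' - B := by
        have : (1 + B ^ 2) * (B * s) = (1 + B ^ 2) * (-s' - B) := by
          linear_combination B * hσ - hτ
        exact mul_left_cancel₀ (by positivity) this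
      linear_combination hdisk + (-(X ^ 2 + X' ^ 2)) * hs + 2 * X * hB1 + (2 * X' + A + B) * hB2
    · have := diametral_mono (E := (X - 1) ^ 2 + (X' - h) ^ 2)
        (b := (X - 1) * (-z') + (X' - h) * z) (t := γ) (t' := δ) (m := 0) (M := max γ δ)
        (by
          linear_combination sq_nonneg ((X - 1) * z + (X' - h) * z')
            + ((X - 1) ^ 2 + (X' - h) ^ 2) * hz)
        (by
          rw [hCx, hCy, hDx, hDy] at hcon
          linear_combination hcon - γ * δ * hz)
        hγ (le_max_left _ _) hδ (le_max_right _ _)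
      linear_combination this
  · have hza := hzz.resolve_left (not_lt.2 hz')
    have ha' : a' < 0 := by
      refine lt_of_le_of_ne hab ?_
      rintro rfl
      have h1 : a < 0 := by
        by_contra hcon
        push Not at hcon
        have := mul_nonpos_of_nonneg_of_nonpos hcon hsb.le
        linarith
      have := mul_nonneg_of_nonpos_of_nonpos hz' h1.le
      linarith
    have ha1 : a < 1 := lt_one_of_sq_add_sq ha ha'.ne
    set p := z' / a' with hp
    have hpa : p * a' = z' := div_mul_cancel₀ z' ha'.ne
    have hp0 : 0 ≤ p := div_nonneg_of_nonpos hz' hab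
    clear_value p
    obtain ⟨q, hq⟩ : ∃ q, q = z - p * a := ⟨_, rfl⟩
    have hq0 : q < 0 := by
      have : 0 < q * a' := by rw [hq]; linear_combination hza + a * hpa
      exact (neg_iff_neg_of_mul_pos this).2 ha'
    have hpq : (p + q) ^ 2 = 1 + 2 * (p * q * (1 - a)) := by
      have hz1 : z = p * a + q := by linarith
      rw [hz1, ← hpa] at hz
      linear_combination hz - p ^ 2 * ha
    have hpq1 : p + q < 1 := by
      by_contra hcon
      push Not at hcon
      have hp1 : 0 < p := by linarith
      have h1 := mul_pos (mul_pos hp1 (neg_pos.2 hq0)) (sub_pos.2 ha1)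
      have h2 : 1 ≤ (p + q) ^ 2 := one_le_pow₀ hcon
      linarith
    have hpqn : p + q < 0 := by
      have h1 : 1 ≤ p * (C * a + C' * a') + q * C := by
        have : C * z + C' * z' = p * (C * a + C' * a') + q * C := by
          rw [hq]; linear_combination (-C') * hpa
        linarith
      have h2 := mul_le_mul_of_nonneg_left hCa hp0
      have h3 : 1 ≤ (p + q) * C := by linarith
      by_contra hcon
      push Not at hcon
      have := mul_le_mul_of_nonneg_left hC1 hcon
      linarith
    have neg : ∀ x y : ℝ, x * z + y * z' = d → x * a + y * a' ≤ x → y * z - x * z' < 0 := by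
      intro x y h1 h2
      have h3 : (y * z - x * z') * ((p + q) * a') ≤ d * (1 - a) * (q - p) := by
        obtain ⟨γ, hγ⟩ : ∃ γ, γ = y * z - x * z' := ⟨_, rfl⟩
        have hx : x = d * z - γ * z' := by rw [← h1, hγ]; linear_combination (-x) * hz
        have hy : y = d * z' + γ * z := by rw [← h1, hγ]; linear_combination (-y) * hz
        have e3 : z * (1 - a) - z' * a' = (1 - a) * (q - p) := by
          rw [hq, ← hpa]; linear_combination (-p) * ha
        have e4 : z' * (1 - a) + z * a' = (p + q) * a' := by
          rw [hq]; linear_combination (a - 1) * hpa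
        rw [← hγ]
        have h5 : 0 ≤ x * (1 - a) - y * a' := by linarith
        rw [hx, hy] at h5
        linear_combination h5 + d * e3 - γ * e4
      have h4 : d * (1 - a) * (q - p) < 0 :=
        mul_neg_of_pos_of_neg (mul_pos (by linarith) (by linarith)) (by linarith)
      have h5 : 0 < (p + q) * a' := mul_pos_of_neg_of_neg hpqn ha'
      by_contra hcon
      push Not at hcon
      have := mul_nonneg hcon h5.le
      linarith
    have hCn := neg C C' hC hCa
    have hDn := neg D D' hD hDa
    have hs1 := sector_bound hA hB hAB hdisk
    have hs2 := sector_bound (A := B) (B := A) (α := X * s + X' * s' - 1)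
      (β := -(X' * s - X * s')) hB hA (by linarith) (by linarith)
    have hXb : X' ≤ 0 := by
      have : 0 ≤ (1 + B ^ 2) * (-X') := by
        linear_combination hs1 - (X * s + X' * s') * hτ + (X' * s - X * s') * hσ
          - X' * (1 + B ^ 2) * hs
      have := (mul_nonneg_iff_of_pos_left (by positivity)).1 this
      linarith
    have hXa : 0 ≤ X' * a - X * a' := by
      have : 0 ≤ (1 + A ^ 2) * (X' * a - X * a') := by
        linear_combination hs2 - (X * s + X' * s') * hA3 - (X' * s - X * s') * hA2
          + (X' * a - X * a') * (1 + A ^ 2) * hs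
      exact (mul_nonneg_iff_of_pos_left (by positivity)).1 this
    have hXz : 0 ≤ X' * z - X * z' := by
      have h1 := mul_nonneg hp0 hXa
      have h2 := mul_nonneg_of_nonpos_of_nonpos hq0.le hXb
      have : X' * z - X * z' = p * (X' * a - X * a') + q * X' := by
        rw [hq]; linear_combination X * hpa
      linarith
    have h1 : 0 < (X' * z - X * z' - (C' * z - C * z')) * (X' * z - X * z' - (D' * z - D * z')) :=
      mul_pos (by linarith) (by linarith)
    have h2 : (X * z + X' * z' - (C * z + C' * z')) * (X * z + X' * z' - (D * z + D' * z'))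
        = (X * z + X' * z' - d) ^ 2 := by rw [hC, hD]; ring
    have h3 : (X - C) * (X - D) + (X' - C') * (X' - D')
        = (X * z + X' * z' - (C * z + C' * z')) * (X * z + X' * z' - (D * z + D' * z')) +
        (X' * z - X * z' - (C' * z - C * z')) * (X' * z - X * z' - (D' * z - D * z')) := by
      linear_combination (-((X - C) * (X - D) + (X' - C') * (X' - D'))) * hz
    rw [h3, h2]
    have := sq_nonneg (X * z + X' * z' - d)
    linarith

/-- The Euclidean inner product of two plane vectors. -/
def dt (u v : ℝ × ℝ) : ℝ := u.1 * v.1 + u.2 * v.2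

/-- The cross product (determinant) of two plane vectors. -/
def cr (u v : ℝ × ℝ) : ℝ := u.1 * v.2 - u.2 * v.1

lemma cr_swap (u v : ℝ × ℝ) : cr u v = -cr v u := by simp only [cr]; ring

lemma dt_comm (u v : ℝ × ℝ) : dt u v = dt v u := by simp only [dt]; ring

lemma dt_eq_frame {e : ℝ × ℝ} (he : dt e e = 1) (u v : ℝ × ℝ) :
    dt u v = dt e u * dt e v + cr e u * cr e v := by
  simp only [dt, cr] at *
  linear_combination (-(u.1 * v.1 + u.2 * v.2)) * he

lemma cr_eq_frame {e : ℝ × ℝ} (he : dt e e = 1) (u v : ℝ × ℝ) :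
    cr u v = dt e u * cr e v - cr e u * dt e v := by
  simp only [dt, cr] at *
  linear_combination (-(u.1 * v.2 - u.2 * v.1)) * he

lemma eq_of_frame {e u v : ℝ × ℝ} (he : dt e e = 1) (h1 : dt e u = dt e v)
    (h2 : cr e u = cr e v) : u = v := by
  simp only [dt, cr] at *
  ext
  · linear_combination (-(u.1 - v.1)) * he + e.1 * h1 - e.2 * h2
  · linear_combination (-(u.2 - v.2)) * he + e.2 * h1 + e.1 * h2

lemma cr_self (u : ℝ × ℝ) : cr u u = 0 := by simp only [cr]; ring

lemma dt_sq_add_cr_sq {u v : ℝ × ℝ} (hu : dt u u = 1) (hv : dt v v = 1) :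
    dt u v ^ 2 + cr u v ^ 2 = 1 := by
  have := dt_eq_frame hu v v
  rw [hv] at this
  linarith

lemma eq_neg_of_cr_eq_zero {u v : ℝ × ℝ} (hu : dt u u = 1) (hv : dt v v = 1) (huv : v ≠ u)
    (h : cr u v = 0) : v = -u := by
  have h1 : dt u v ^ 2 = 1 := by have := dt_sq_add_cr_sq hu hv; rw [h] at this; linarith
  rcases sq_eq_one_iff.1 h1 with h2 | h2
  · exact absurd (eq_of_frame hu (h2.trans hu.symm) (h.trans (cr_self u).symm)) huv
  · refine eq_of_frame hu (h2.trans ?_) (h.trans ?_)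
    · rw [← hu]; simp only [dt, Prod.fst_neg, Prod.snd_neg]; ring
    · simp only [cr, Prod.fst_neg, Prod.snd_neg]; ring

lemma cr_neg_right (u v : ℝ × ℝ) : cr u (-v) = -cr u v := by
  simp only [cr, Prod.fst_neg, Prod.snd_neg]; ring

lemma cr_neg_left (u v : ℝ × ℝ) : cr (-u) v = -cr u v := by
  simp only [cr, Prod.fst_neg, Prod.snd_neg]; ring

lemma dt_lt_of_between {a s b : ℝ × ℝ} (ha : dt a a = 1) (hs : dt s s = 1) (hb : dt b b = 1)
    (has : 0 < cr a s) (hsb : 0 < cr s b) (hab : 0 ≤ cr a b) :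
    dt a b < dt a s ∧ dt a b < dt s b := by
  have h1 := dt_sq_add_cr_sq ha hs
  have h2 := dt_sq_add_cr_sq hs hb
  have h3 := dt_eq_frame hs a b
  have h4 := cr_eq_frame hs a b
  rw [cr_swap s a, dt_comm s a] at h3 h4
  have h5 : dt a s < 1 := lt_one_of_sq_add_sq h1 has.ne'
  have h6 : dt s b < 1 := lt_one_of_sq_add_sq h2 hsb.ne'
  constructor
  · have : 0 < cr s b * (dt a s - dt a b) := by
      have := mul_pos (sub_pos.2 h6) (add_pos_of_nonneg_of_pos hab has)
      rw [h4] at this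
      rw [h3]
      linear_combination this - cr a s * h2
    linarith [(mul_pos_iff_of_pos_left hsb).1 this]
  · have : 0 < cr a s * (dt s b - dt a b) := by
      have := mul_pos (sub_pos.2 h5) (add_pos_of_nonneg_of_pos hab hsb)
      rw [h4] at this
      rw [h3]
      linear_combination this - cr s b * h1
    linarith [(mul_pos_iff_of_pos_left has).1 this]

/-- Twice the signed area of the triangle `abz`. -/
def tri (a b z : ℝ × ℝ) : ℝ := cr a b + cr b z + cr z a

lemma cr_sq_eq {a b z : ℝ × ℝ} (ha : dt a a = 1) (hb : dt b b = 1) (hz : dt z z = 1) :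
    cr a b ^ 2 = cr b z ^ 2 + cr z a ^ 2 + 2 * (cr b z * cr z a) * dt a b := by
  have h1 := dt_sq_add_cr_sq ha hz
  have h2 := dt_sq_add_cr_sq ha hb
  rw [cr_eq_frame ha b z, cr_swap z a]
  linear_combination (-cr a b ^ 2) * h1 + cr a z ^ 2 * h2

lemma tri_neg_of_between {a b z : ℝ × ℝ} (ha : dt a a = 1) (hb : dt b b = 1) (hz : dt z z = 1)
    (hab : 0 < cr a b) (h1 : 0 < cr a z) (h2 : 0 < cr z b) : tri a b z < 0 := by
  have h3 := cr_sq_eq ha hb hz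
  have h5 : dt a b < 1 := lt_one_of_sq_add_sq (dt_sq_add_cr_sq ha hb) hab.ne'
  rw [cr_swap b z, cr_swap z a] at h3
  rw [tri, cr_swap b z, cr_swap z a]
  have h4 := mul_pos (mul_pos h1 h2) (sub_pos.2 h5)
  have : cr a b ^ 2 < (cr a z + cr z b) ^ 2 := by linarith
  have := lt_of_pow_lt_pow_left₀ 2 (by positivity) this
  linarith

lemma tri_pos_of_not_between {a b z : ℝ × ℝ} (ha : dt a a = 1) (hb : dt b b = 1)
    (hz : dt z z = 1) (hab : 0 < cr a b) (hza : z ≠ a) (hzb : z ≠ b)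
    (h : ¬(0 < cr a z ∧ 0 < cr z b)) : 0 < tri a b z := by
  have h3 := cr_sq_eq ha hb hz
  have h5 : dt a b < 1 := lt_one_of_sq_add_sq (dt_sq_add_cr_sq ha hb) hab.ne'
  rw [cr_swap b z, cr_swap z a] at h3
  rw [tri, cr_swap b z, cr_swap z a]
  rcases eq_or_ne (cr a z) 0 with h0 | h0
  · obtain rfl := eq_neg_of_cr_eq_zero ha hz hza h0
    rw [cr_neg_left, h0]
    linarith
  rcases eq_or_ne (cr z b) 0 with h0' | h0'
  · obtain rfl := eq_neg_of_cr_eq_zero hb hz hzb (by rw [cr_swap, h0', neg_zero])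
    rw [cr_neg_right, h0']
    linarith
  by_contra hcon
  push Not at hcon
  have h6 : cr a b ^ 2 ≤ (cr a z + cr z b) ^ 2 := pow_le_pow_left₀ hab.le (by linarith) 2
  have h7 : 0 ≤ (cr a z * cr z b) * (1 - dt a b) := by linarith
  have h8 := (mul_nonneg_iff_of_pos_right (sub_pos.2 h5)).1 h7
  have h9 : 0 < cr a z * cr z b := lt_of_le_of_ne h8 (mul_ne_zero h0 h0').symm
  rcases pos_and_pos_or_neg_and_neg_of_mul_pos h9 with h10 | h10
  · exact h h10
  · linarith [h10.1, h10.2]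

lemma tri_pos_of_outside {a s b z : ℝ × ℝ} (ha : dt a a = 1) (hb : dt b b = 1)
    (hz : dt z z = 1) (has : 0 < cr a s) (hsb : 0 < cr s b) (hab : 0 ≤ cr a b)
    (hza : z ≠ a) (hzb : z ≠ b) (h : 0 < cr b z ∨ 0 < cr z a) : 0 < tri a b z := by
  rcases hab.lt_or_eq with hab | hab
  · refine tri_pos_of_not_between ha hb hz hab hza hzb ?_
    rintro ⟨h1, h2⟩
    rw [cr_swap] at h1 h2
    rcases h with h | h <;> linarith
  · have hba : b ≠ a := by
      rintro rfl
      rw [cr_swap] at hsb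
      linarith
    obtain rfl := eq_neg_of_cr_eq_zero ha hb hba hab.symm
    rw [tri, ← hab]
    rw [cr_neg_left, cr_swap] at *
    rcases h with h | h <;> linarith

lemma between_of_positive_combination {i j z w : ℝ × ℝ} (hi : dt i i = 1) (hj : dt j j = 1)
    (hz : dt z z = 1) (hw : dt w w = 1) (hij : 0 < cr i j) (hjz : 0 < cr j z) (hzi : 0 < cr z i)
    (hwi : w ≠ i) (hwj : w ≠ j) (hwz : w ≠ z) :
    (0 < cr i w ∧ 0 < cr w j) ∨ (0 < cr j w ∧ 0 < cr w z) ∨ (0 < cr z w ∧ 0 < cr w i) := by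
  rcases eq_or_ne (cr i w) 0 with h | hu
  · obtain rfl := eq_neg_of_cr_eq_zero hi hw hwi h
    right; left
    rw [cr_neg_right, cr_neg_left, cr_swap j i, cr_swap i z]
    constructor <;> linarith
  rcases eq_or_ne (cr j w) 0 with h | hv
  · obtain rfl := eq_neg_of_cr_eq_zero hj hw hwj h
    right; right
    rw [cr_neg_right, cr_neg_left, cr_swap j i, cr_swap z j]
    constructor <;> linarith
  rcases eq_or_ne (cr z w) 0 with h | ht
  · obtain rfl := eq_neg_of_cr_eq_zero hz hw hwz h
    left
    rw [cr_neg_right, cr_neg_left, cr_swap i z, cr_swap z j]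
    constructor <;> linarith
  have hsum : cr j z * cr i w + cr z i * cr j w + cr i j * cr z w = 0 := by
    simp only [cr]; ring
  rw [cr_swap w j, cr_swap w z, cr_swap w i]
  rcases hu.lt_or_gt with hu | hu <;> rcases hv.lt_or_gt with hv | hv <;>
    rcases ht.lt_or_gt with ht | ht
  · have h1 := mul_neg_of_pos_of_neg hjz hu
    have h2 := mul_neg_of_pos_of_neg hzi hv
    have h3 := mul_neg_of_pos_of_neg hij ht
    linarith
  · exact Or.inr (Or.inr ⟨ht, by linarith⟩)
  · exact Or.inr (Or.inl ⟨hv, by linarith⟩)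
  · exact Or.inr (Or.inr ⟨ht, by linarith⟩)
  · exact Or.inl ⟨hu, by linarith⟩
  · exact Or.inl ⟨hu, by linarith⟩
  · exact Or.inr (Or.inl ⟨hv, by linarith⟩)
  · have h1 := mul_pos hjz hu
    have h2 := mul_pos hzi hv
    have h3 := mul_pos hij ht
    linarith

lemma separated_of_above_axis {a s b z O C D P Q X : ℝ × ℝ} {r d : ℝ} (hr : 0 < r)
    (ha : dt a a = 1) (hs : dt s s = 1) (hb : dt b b = 1) (hz : dt z z = 1)
    (has : 0 < cr a s) (hsb : 0 < cr s b) (hab : 0 ≤ cr a b) (hzz : 0 < cr b z ∨ 0 < cr z a)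
    (hd : r ≤ d) (hC : dt z (C - O) = d) (hD : dt z (D - O) = d)
    (hCb : dt b (C - O) ≤ r) (hDb : dt b (D - O) ≤ r)
    (hCa : dt a (C - O) ≤ dt b (C - O)) (hDa : dt a (D - O) ≤ dt b (D - O))
    (hP : dt s (P - O) = r) (hQ : dt s (Q - O) = r)
    (hPb : dt b (P - O) ≤ r) (hQb : dt b (Q - O) ≤ r)
    (hPa : dt a (P - O) ≤ r) (hQa : dt a (Q - O) ≤ r)
    (hX : dt (X - P) (X - Q) ≤ 0) : 0 < dt (X - C) (X - D) := by
  have fr : ∀ u v : ℝ × ℝ, dt b v / r * dt b u + cr b v / r * cr b u = dt u v / r := by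
    intro u v
    rw [dt_eq_frame hb u v]; ring
  have fr2 : ∀ u v : ℝ × ℝ, (dt b (X - O) / r - dt b (u - O) / r) *
      (dt b (X - O) / r - dt b (v - O) / r) + (cr b (X - O) / r - cr b (u - O) / r) *
      (cr b (X - O) / r - cr b (v - O) / r) = dt (X - u) (X - v) / r ^ 2 := by
    intro u v
    rw [dt_eq_frame hb (X - u) (X - v)]
    simp only [dt, cr, Prod.fst_sub, Prod.snd_sub]
    ring
  have := separated_frame (a := dt b a) (a' := cr b a) (s := dt b s) (s' := cr b s)
    (z := dt b z) (z' := cr b z) (C := dt b (C - O) / r) (C' := cr b (C - O) / r)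
    (D := dt b (D - O) / r) (D' := cr b (D - O) / r)
    (P := dt b (P - O) / r) (P' := cr b (P - O) / r)
    (Q := dt b (Q - O) / r) (Q' := cr b (Q - O) / r)
    (X := dt b (X - O) / r) (X' := cr b (X - O) / r) (d := d / r)
    (dt_sq_add_cr_sq hb ha) (dt_sq_add_cr_sq hb hs) (dt_sq_add_cr_sq hb hz)
    (by rw [← cr_eq_frame hb]; exact has) (by rw [cr_swap] at hsb; linarith)
    (by rw [cr_swap] at hab; linarith) (by rw [← cr_eq_frame hb]; exact hzz)
    ((one_le_div hr).2 hd) (by rw [fr, hC]) (by rw [fr, hD])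
    ((div_le_one hr).2 hCb) ((div_le_one hr).2 hDb)
    (by rw [fr]; gcongr) (by rw [fr]; gcongr)
    (by rw [fr, hP]; exact div_self hr.ne') (by rw [fr, hQ]; exact div_self hr.ne')
    ((div_le_one hr).2 hPb) ((div_le_one hr).2 hQb)
    (by rw [fr]; exact (div_le_one hr).2 hPa) (by rw [fr]; exact (div_le_one hr).2 hQa)
    (by rw [fr2]; exact div_nonpos_of_nonpos_of_nonneg hX (by positivity))
  rw [fr2] at this
  exact (div_pos_iff_of_pos_right (by positivity)).1 this

lemma separated_of_below_axis {a s b z O C D P Q X : ℝ × ℝ} {r d : ℝ} (hr : 0 < r)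
    (ha : dt a a = 1) (hs : dt s s = 1) (hb : dt b b = 1) (hz : dt z z = 1)
    (has : 0 < cr a s) (hsb : 0 < cr s b) (hab : 0 ≤ cr a b) (hzz : 0 < cr b z ∨ 0 < cr z a)
    (hd : r ≤ d) (hC : dt z (C - O) = d) (hD : dt z (D - O) = d)
    (hCa : dt a (C - O) ≤ r) (hDa : dt a (D - O) ≤ r)
    (hCb : dt b (C - O) ≤ dt a (C - O)) (hDb : dt b (D - O) ≤ dt a (D - O))
    (hP : dt s (P - O) = r) (hQ : dt s (Q - O) = r)
    (hPb : dt b (P - O) ≤ r) (hQb : dt b (Q - O) ≤ r)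
    (hPa : dt a (P - O) ≤ r) (hQa : dt a (Q - O) ≤ r)
    (hX : dt (X - P) (X - Q) ≤ 0) : 0 < dt (X - C) (X - D) := by
  let m : ℝ × ℝ → ℝ × ℝ := fun v => (v.1, -v.2)
  have hdt : ∀ u v, dt (m u) (m v) = dt u v := by intro u v; simp only [dt, m]; ring
  have hcr : ∀ u v, cr (m u) (m v) = cr v u := by intro u v; simp only [cr, m]; ring
  have hsub : ∀ u v, m u - m v = m (u - v) := by
    intro u v
    ext
    · simp only [m, Prod.fst_sub]
    · simp only [m, Prod.snd_sub]; ring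
  have := separated_of_above_axis (a := m b) (s := m s) (b := m a) (z := m z) (O := m O)
    (C := m C) (D := m D) (P := m P) (Q := m Q) (X := m X) (r := r) (d := d)
  simp only [hdt, hcr, hsub] at this
  exact this hr hb hs ha hz hsb has hab hzz.symm hd hC hD hCa hDa hCb hDb hP hQ hPa hQa hPb hQb hX

/-- Finitely many segments in convex position: segment `i` joins `C i` to `D i` on the line
`dt (N i) X = h i`, every endpoint lies in all the half-planes `dt (N j) X ≤ h j`, and no segment
lies on the line of another one. -/
structure SegmentSystem (ι : Type*) where
  N : ι → ℝ × ℝ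
  h : ι → ℝ
  C : ι → ℝ × ℝ
  D : ι → ℝ × ℝ
  unit : ∀ i, dt (N i) (N i) = 1
  dt_C : ∀ i, dt (N i) (C i) = h i
  dt_D : ∀ i, dt (N i) (D i) = h i
  le_C : ∀ i j, dt (N j) (C i) ≤ h j
  le_D : ∀ i j, dt (N j) (D i) ≤ h j
  ne : ∀ i, C i ≠ D i
  strict : ∀ i j, i ≠ j → dt (N j) (C i) = h j → dt (N j) (D i) ≠ h j

namespace SegmentSystem

variable {ι : Type*} (S : SegmentSystem ι)

/-- The signed distance from `X` to the line of segment `i`, positive inside. -/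
def gap (i : ι) (X : ℝ × ℝ) : ℝ := S.h i - dt (S.N i) X

/-- The disks with diameters the segments `i` and `j` do not meet. -/
def Apart (i j : ι) : Prop :=
  ∀ X, dt (X - S.C i) (X - S.D i) ≤ 0 → 0 < dt (X - S.C j) (X - S.D j)

lemma Apart.symm {S : SegmentSystem ι} {i j : ι} (h : S.Apart i j) : S.Apart j i := by
  intro X hX
  by_contra hcon
  exact absurd (h X (not_lt.1 hcon)) (not_lt.2 hX)

lemma N_ne {i j : ι} (hij : i ≠ j) : S.N i ≠ S.N j := by
  intro h
  have h1 := S.le_C i j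
  have h2 := S.le_C j i
  have h3 := S.dt_C i
  have h4 := S.dt_D i
  have h5 := S.dt_C j
  rw [h] at h2 h3 h4
  have h6 : S.h i = S.h j := by linarith
  exact S.strict i j hij (h3.trans h6) (h4.trans h6)

/-- The (generalised) circle with centre `O` and signed radius `r` touches the lines `a`, `s`, `b`,
whose normals occur in this cyclic order within a half-turn, and crosses no line of `F`. -/
structure Touches (F : Finset ι) (a s b : ι) (O : ℝ × ℝ) (r : ℝ) : Prop where
  le_gap : ∀ z ∈ F, r ≤ S.gap z O
  mem_a : a ∈ F
  mem_s : s ∈ F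
  mem_b : b ∈ F
  cr_as : 0 < cr (S.N a) (S.N s)
  cr_sb : 0 < cr (S.N s) (S.N b)
  cr_ab : 0 ≤ cr (S.N a) (S.N b)
  gap_a : S.gap a O = r
  gap_s : S.gap s O = r
  gap_b : S.gap b O = r

/-- Moving the centre of a circle along the bisector of two touched lines. -/
lemma gap_slide (a s z : ι) (O : ℝ × ℝ) (r t : ℝ) :
    S.gap z (O + t • ((S.N s).2 - (S.N a).2, (S.N a).1 - (S.N s).1))
      - (r - t * cr (S.N a) (S.N s)) = S.gap z O - r + t * tri (S.N a) (S.N s) (S.N z) := by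
  simp only [gap, dt, cr, tri, Prod.fst_add, Prod.snd_add, Prod.smul_fst, Prod.smul_snd,
    smul_eq_mul]
  ring

lemma tri_left (a b : ℝ × ℝ) : tri a b a = 0 := by simp only [tri, cr]; ring

lemma tri_right (a b : ℝ × ℝ) : tri a b b = 0 := by simp only [tri, cr]; ring

lemma exists_touches_of_between {F : Finset ι} {a s w : ι} {O : ℝ × ℝ} {r : ℝ}
    (hK : ∀ z ∈ F, r ≤ S.gap z O) (ha : a ∈ F) (hs : s ∈ F) (hga : S.gap a O = r)
    (hgs : S.gap s O = r) (has : 0 < cr (S.N a) (S.N s)) (hw : w ∈ F)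
    (haw : 0 < cr (S.N a) (S.N w)) (hws : 0 < cr (S.N w) (S.N s)) :
    ∃ m O' r', S.Touches F a m s O' r' := by
  classical
  let G := F.filter fun z => 0 < cr (S.N a) (S.N z) ∧ 0 < cr (S.N z) (S.N s)
  have hG : G.Nonempty := ⟨w, Finset.mem_filter.2 ⟨hw, haw, hws⟩⟩
  obtain ⟨m, hm, hmin⟩ := Finset.exists_min_image G
    (fun z => (S.gap z O - r) / -tri (S.N a) (S.N s) (S.N z)) hG
  obtain ⟨hmF, ham, hms⟩ := Finset.mem_filter.1 hm
  have hT : ∀ z ∈ G, tri (S.N a) (S.N s) (S.N z) < 0 := fun z hz =>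
    tri_neg_of_between (S.unit a) (S.unit s) (S.unit z) has
      (Finset.mem_filter.1 hz).2.1 (Finset.mem_filter.1 hz).2.2
  have hTm := hT m hm
  obtain ⟨t, ht⟩ : ∃ t, t = (S.gap m O - r) / -tri (S.N a) (S.N s) (S.N m) := ⟨_, rfl⟩
  have ht0 : 0 ≤ t := by
    rw [ht]; exact div_nonneg (by linarith [hK m hmF]) (by linarith)
  have key := fun z => S.gap_slide a s z O r t
  have htm : t * tri (S.N a) (S.N s) (S.N m) = -(S.gap m O - r) := by
    rw [ht, div_neg, neg_mul, div_mul_cancel₀ _ hTm.ne]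
  refine ⟨m, O + t • ((S.N s).2 - (S.N a).2, (S.N a).1 - (S.N s).1),
    r - t * cr (S.N a) (S.N s), ?_, ha, hmF, hs, ham, hms, has.le, ?_, ?_, ?_⟩
  rotate_left
  · have := key a
    rw [tri_left] at this
    linarith
  · have := key m
    linarith
  · have := key s
    rw [tri_right] at this
    linarith
  intro z hz
  have hkz := key z
  by_cases hzG : z ∈ G
  · have h1 := hmin z hzG
    have h2 := hT z hzG
    simp only [← ht] at h1
    rw [le_div_iff₀ (by linarith)] at h1
    linarith
  · have h0 : 0 ≤ tri (S.N a) (S.N s) (S.N z) := by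
      rcases eq_or_ne z a with rfl | hza
      · rw [tri_left]
      rcases eq_or_ne z s with rfl | hzs
      · rw [tri_right]
      exact (tri_pos_of_not_between (S.unit a) (S.unit s) (S.unit z) has (S.N_ne hza) (S.N_ne hzs)
        fun h => hzG (Finset.mem_filter.2 ⟨hz, h⟩)).le
    have := mul_nonneg ht0 h0
    linarith [hK z hz]

lemma exists_cr_pos {F : Finset ι} (hF : 3 ≤ F.card) :
    ∃ i ∈ F, ∃ j ∈ F, 0 < cr (S.N i) (S.N j) := by
  obtain ⟨i, j, k, hi, hj, hk, hij, hik, hjk⟩ := Finset.two_lt_card_iff.1 hF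
  by_contra hcon
  push Not at hcon
  have h0 : ∀ x ∈ F, cr (S.N i) (S.N x) = 0 := by
    intro x hx
    have h1 := hcon i hi x hx
    have h2 := hcon x hx i hi
    rw [cr_swap] at h2
    linarith
  have h1 := eq_neg_of_cr_eq_zero (S.unit i) (S.unit j) (S.N_ne hij.symm) (h0 j hj)
  have h2 := eq_neg_of_cr_eq_zero (S.unit i) (S.unit k) (S.N_ne hik.symm) (h0 k hk)
  exact S.N_ne hjk (h1.trans h2.symm)

lemma exists_common_point {i j : ι} (hij : 0 < cr (S.N i) (S.N j)) :
    ∃ W, S.gap i W = 0 ∧ S.gap j W = 0 := by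
  refine ⟨((S.h i * (S.N j).2 - S.h j * (S.N i).2) / cr (S.N i) (S.N j),
    ((S.N i).1 * S.h j - (S.N j).1 * S.h i) / cr (S.N i) (S.N j)), ?_, ?_⟩
  · have := hij.ne'
    simp only [gap, dt]
    field_simp
    simp only [cr]
    ring
  · have := hij.ne'
    simp only [gap, dt]
    field_simp
    simp only [cr]
    ring

lemma exists_touches {F : Finset ι} (hF : 4 ≤ F.card) : ∃ a s b O r, S.Touches F a s b O r := by
  classical
  obtain ⟨⟨i, j⟩, hijm, hmax⟩ := Finset.exists_max_image
    ((F ×ˢ F).filter fun p => 0 < cr (S.N p.1) (S.N p.2)) (fun p => dt (S.N p.1) (S.N p.2)) (by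
      obtain ⟨i, hi, j, hj, h⟩ := S.exists_cr_pos (F := F) (by omega)
      exact ⟨(i, j), Finset.mem_filter.2 ⟨Finset.mk_mem_product hi hj, h⟩⟩)
  simp only [Finset.mem_filter, Finset.mem_product] at hijm hmax
  obtain ⟨⟨hi, hj⟩, hij⟩ := hijm
  have hnb : ∀ z ∈ F, ¬(0 < cr (S.N i) (S.N z) ∧ 0 < cr (S.N z) (S.N j)) := by
    rintro z hz ⟨h1, h2⟩
    have h3 := (dt_lt_of_between (S.unit i) (S.unit z) (S.unit j) h1 h2 hij.le).1
    have h4 := hmax (i, z) ⟨⟨hi, hz⟩, h1⟩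
    exact absurd h3 (not_lt.2 h4)
  have hne : i ≠ j := by
    rintro rfl
    rw [cr_self] at hij
    exact lt_irrefl _ hij
  have hT : ∀ z ∈ F, z ≠ i → z ≠ j → 0 < tri (S.N i) (S.N j) (S.N z) := fun z hz h1 h2 =>
    tri_pos_of_not_between (S.unit i) (S.unit j) (S.unit z) hij (S.N_ne h1) (S.N_ne h2) (hnb z hz)
  obtain ⟨W, hWi, hWj⟩ := S.exists_common_point hij
  obtain ⟨z, hzm, hzmax⟩ := Finset.exists_max_image ((F.erase i).erase j)
    (fun z => -S.gap z W / tri (S.N i) (S.N j) (S.N z)) (by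
      rw [← Finset.card_pos, Finset.card_erase_of_mem (Finset.mem_erase.2 ⟨hne.symm, hj⟩),
        Finset.card_erase_of_mem hi]
      omega)
  simp only [Finset.mem_erase] at hzm hzmax
  obtain ⟨hzj, hzi, hz⟩ := hzm
  have hTz := hT z hz hzi hzj
  obtain ⟨t, ht⟩ : ∃ t, t = -S.gap z W / tri (S.N i) (S.N j) (S.N z) := ⟨_, rfl⟩
  have htz : t * tri (S.N i) (S.N j) (S.N z) = -S.gap z W := by
    rw [ht, div_mul_cancel₀ _ hTz.ne']
  have key := fun z => S.gap_slide i j z W 0 t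
  obtain ⟨O, hO⟩ : ∃ O, O = W + t • ((S.N j).2 - (S.N i).2, (S.N i).1 - (S.N j).1) := ⟨_, rfl⟩
  obtain ⟨r, hr⟩ : ∃ r, r = 0 - t * cr (S.N i) (S.N j) := ⟨_, rfl⟩
  simp only [← hO, ← hr] at key
  have gi : S.gap i O = r := by have := key i; rw [tri_left] at this; linarith
  have gj : S.gap j O = r := by have := key j; rw [tri_right] at this; linarith
  have gz : S.gap z O = r := by have := key z; linarith
  have hK : ∀ y ∈ F, r ≤ S.gap y O := by
    intro y hy
    rcases eq_or_ne y i with rfl | hyi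
    · exact gi.ge
    rcases eq_or_ne y j with rfl | hyj
    · exact gj.ge
    have h1 := hzmax y ⟨hyj, hyi, hy⟩
    rw [← ht, div_le_iff₀ (hT y hy hyi hyj)] at h1
    have := key y
    linarith
  rcases lt_or_ge 0 (cr (S.N j) (S.N z)) with hA | hA <;>
    rcases lt_or_ge 0 (cr (S.N z) (S.N i)) with hB | hB
  · obtain ⟨w, hw⟩ : (((F.erase i).erase j).erase z).Nonempty := by
      rw [← Finset.card_pos, Finset.card_erase_of_mem (by simp [hzj, hzi, hz]),
        Finset.card_erase_of_mem (Finset.mem_erase.2 ⟨hne.symm, hj⟩), Finset.card_erase_of_mem hi]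
      omega
    simp only [Finset.mem_erase] at hw
    obtain ⟨hwz, hwj, hwi, hw⟩ := hw
    rcases between_of_positive_combination (S.unit i) (S.unit j) (S.unit z) (S.unit w) hij hA hB
      (S.N_ne hwi) (S.N_ne hwj) (S.N_ne hwz) with h | h | h
    · exact absurd h (hnb w hw)
    · obtain ⟨m, O', r', h'⟩ := S.exists_touches_of_between hK hj hz gj gz hA hw h.1 h.2
      exact ⟨_, _, _, _, _, h'⟩
    · obtain ⟨m, O', r', h'⟩ := S.exists_touches_of_between hK hz hi gz gi hB hw h.1 h.2
      exact ⟨_, _, _, _, _, h'⟩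
  · exact ⟨i, j, z, O, r, hK, hi, hj, hz, hij, hA, by rw [cr_swap]; linarith, gi, gj, gz⟩
  · exact ⟨z, i, j, O, r, hK, hz, hi, hj, hB, hij, by rw [cr_swap]; linarith, gz, gi, gj⟩
  · exfalso
    have h1 := hnb z hz
    rw [cr_swap (S.N i), cr_swap (S.N z) (S.N j)] at h1
    rcases hB.lt_or_eq with hB | hB
    · rcases hA.lt_or_eq with hA | hA
      · exact h1 ⟨by linarith, by linarith⟩
      · have := eq_neg_of_cr_eq_zero (S.unit j) (S.unit z) (S.N_ne hzj) hA
        rw [this, cr_neg_left, cr_swap] at hB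
        linarith
    · have := eq_neg_of_cr_eq_zero (S.unit i) (S.unit z) (S.N_ne hzi)
        (by rw [cr_swap, hB, neg_zero])
      rw [this, cr_neg_right, cr_swap] at hA
      linarith

lemma Touches.pos {S : SegmentSystem ι} {F : Finset ι} {a s b : ι} {O : ℝ × ℝ} {r : ℝ}
    (h : S.Touches F a s b O r) : 0 < r := by
  by_contra hcon
  push Not at hcon
  obtain ⟨-, -, -, -, has, hsb, -, ga, gs, gb⟩ := h
  have hu := S.unit s
  have h1 : dt (S.N a) (S.N s) < 1 :=
    lt_one_of_sq_add_sq (dt_sq_add_cr_sq (S.unit a) hu) has.ne'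
  have h2 : dt (S.N s) (S.N b) < 1 :=
    lt_one_of_sq_add_sq (dt_sq_add_cr_sq hu (S.unit b)) hsb.ne'
  have key : ∀ P, dt (S.N s) P = S.h s → dt (S.N a) P ≤ S.h a → dt (S.N b) P ≤ S.h b →
      dt (S.N s) (P - O) = r ∧ cr (S.N s) (P - O) = 0 := by
    intro P hs ha hb
    have sub : ∀ u, dt u (P - O) = dt u P - dt u O := by
      intro u; simp only [dt, Prod.fst_sub, Prod.snd_sub]; ring
    simp only [gap] at ga gs gb
    have es : dt (S.N s) (P - O) = r := by rw [sub]; linarith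
    refine ⟨es, ?_⟩
    have ea : dt (S.N a) (P - O) ≤ r := by rw [sub]; linarith
    have eb : dt (S.N b) (P - O) ≤ r := by rw [sub]; linarith
    rw [dt_eq_frame hu, es, cr_swap, dt_comm] at ea
    rw [dt_eq_frame hu, es] at eb
    have ha' := mul_nonpos_of_nonpos_of_nonneg hcon (sub_pos.2 h1).le
    have hb' := mul_nonpos_of_nonpos_of_nonneg hcon (sub_pos.2 h2).le
    apply le_antisymm
    · have : 0 ≤ cr (S.N s) (S.N b) * -cr (S.N s) (P - O) := by linarith
      linarith [(mul_nonneg_iff_of_pos_left hsb).1 this]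
    · have : 0 ≤ cr (S.N a) (S.N s) * cr (S.N s) (P - O) := by linarith
      exact (mul_nonneg_iff_of_pos_left has).1 this
  have hC := key _ (S.dt_C s) (S.le_C s a) (S.le_C s b)
  have hD := key _ (S.dt_D s) (S.le_D s a) (S.le_D s b)
  exact S.ne s (sub_left_injective
    (eq_of_frame hu (hC.1.trans hD.1.symm) (hC.2.trans hD.2.symm)))

lemma exists_extremal_touches {F : Finset ι} (hF : 4 ≤ F.card) :
    ∃ a s b O r, S.Touches F a s b O r ∧ ∀ z ∈ F, z ≠ a → z ≠ s → z ≠ b →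
      0 < cr (S.N b) (S.N z) ∨ 0 < cr (S.N z) (S.N a) := by
  classical
  obtain ⟨⟨a, s, b⟩, hm, hmax⟩ := Finset.exists_max_image
    ((F ×ˢ F ×ˢ F).filter fun p => ∃ O r, S.Touches F p.1 p.2.1 p.2.2 O r)
    (fun p => dt (S.N p.1) (S.N p.2.2)) (by
      obtain ⟨a, s, b, O, r, h⟩ := S.exists_touches hF
      exact ⟨(a, s, b), Finset.mem_filter.2 ⟨Finset.mk_mem_product h.mem_a
        (Finset.mk_mem_product h.mem_s h.mem_b), O, r, h⟩⟩)
  obtain ⟨-, O, r, h⟩ := Finset.mem_filter.1 hm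
  have hmax' : ∀ a' s' b' O' r', S.Touches F a' s' b' O' r' →
      dt (S.N a') (S.N b') ≤ dt (S.N a) (S.N b) := fun a' s' b' O' r' h' =>
    hmax (a', s', b') (Finset.mem_filter.2 ⟨Finset.mk_mem_product h'.mem_a
        (Finset.mk_mem_product h'.mem_s h'.mem_b), O', r', h'⟩)
  have hdt := dt_lt_of_between (S.unit a) (S.unit s) (S.unit b) h.cr_as h.cr_sb h.cr_ab
  refine ⟨a, s, b, O, r, h, fun z hz hza hzs hzb => ?_⟩
  by_contra hcon
  push Not at hcon
  obtain ⟨h1, h2⟩ := hcon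
  have n1 : ¬(0 < cr (S.N a) (S.N z) ∧ 0 < cr (S.N z) (S.N s)) := by
    rintro ⟨h3, h4⟩
    obtain ⟨m, O', r', h'⟩ := S.exists_touches_of_between h.le_gap h.mem_a h.mem_s h.gap_a h.gap_s
      h.cr_as hz h3 h4
    exact absurd hdt.1 (not_lt.2 (hmax' _ _ _ _ _ h'))
  have n2 : ¬(0 < cr (S.N s) (S.N z) ∧ 0 < cr (S.N z) (S.N b)) := by
    rintro ⟨h3, h4⟩
    obtain ⟨m, O', r', h'⟩ := S.exists_touches_of_between h.le_gap h.mem_s h.mem_b h.gap_s h.gap_b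
      h.cr_sb hz h3 h4
    exact absurd hdt.2 (not_lt.2 (hmax' _ _ _ _ _ h'))
  have has := h.cr_as
  have hsb := h.cr_sb
  rcases lt_trichotomy (cr (S.N s) (S.N z)) 0 with h3 | h3 | h3
  · have h4 : 0 < cr (S.N z) (S.N s) := by rw [cr_swap]; linarith
    have h5 : cr (S.N a) (S.N z) = 0 := by
      rw [cr_swap] at h2
      refine le_antisymm (not_lt.1 fun h => n1 ⟨h, h4⟩) (by linarith)
    rw [eq_neg_of_cr_eq_zero (S.unit a) (S.unit z) (S.N_ne hza) h5, cr_neg_left] at h4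
    linarith
  · rw [eq_neg_of_cr_eq_zero (S.unit s) (S.unit z) (S.N_ne hzs) h3, cr_neg_left, cr_swap] at h2
    linarith
  · have h5 : cr (S.N b) (S.N z) = 0 := by
      have : ¬ 0 < cr (S.N z) (S.N b) := fun h => n2 ⟨h3, h⟩
      rw [cr_swap] at this
      linarith
    rw [eq_neg_of_cr_eq_zero (S.unit b) (S.unit z) (S.N_ne hzb) h5, cr_neg_right] at h3
    linarith

lemma gap_C_nonneg (i j : ι) : 0 ≤ S.gap j (S.C i) := sub_nonneg.2 (S.le_C i j)

lemma gap_D_nonneg (i j : ι) : 0 ≤ S.gap j (S.D i) := sub_nonneg.2 (S.le_D i j)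

lemma gap_C_self (i : ι) : S.gap i (S.C i) = 0 := sub_eq_zero.2 (S.dt_C i).symm

lemma gap_D_self (i : ι) : S.gap i (S.D i) = 0 := sub_eq_zero.2 (S.dt_D i).symm

lemma gap_combination (j : ι) (X Y : ℝ × ℝ) (t : ℝ) :
    S.gap j ((1 - t) • X + t • Y) = (1 - t) * S.gap j X + t * S.gap j Y := by
  simp only [gap, dt, Prod.fst_add, Prod.snd_add, Prod.smul_fst, Prod.smul_snd, smul_eq_mul]
  ring

/-- Segment `z` crosses the bisector of the lines `a` and `b`. -/
def Crosses (a b z : ι) : Prop :=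
  (S.gap a (S.C z) - S.gap b (S.C z)) * (S.gap a (S.D z) - S.gap b (S.D z)) < 0

lemma Crosses.exists_axis_point {S : SegmentSystem ι} {F : Finset ι} {a s b z : ι} {O : ℝ × ℝ}
    {r : ℝ} (h : S.Touches F a s b O r) (hz : z ∈ F) (hza : z ≠ a) (hzb : z ≠ b)
    (hzz : 0 < cr (S.N b) (S.N z) ∨ 0 < cr (S.N z) (S.N a)) (hc : S.Crosses a b z) :
    ∃ t τ, 0 < τ ∧ τ < 1 ∧ 0 < t ∧ 0 < cr (S.N b) (S.N z) + cr (S.N z) (S.N a) ∧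
      t * (cr (S.N b) (S.N z) + cr (S.N z) (S.N a)) = S.gap z O ∧
      ∀ j, S.gap j (O + t • ((S.N a).2 - (S.N b).2, (S.N b).1 - (S.N a).1)) =
        (1 - τ) * S.gap j (S.C z) + τ * S.gap j (S.D z) := by
  obtain ⟨u, hu⟩ : ∃ u, u = S.gap a (S.C z) - S.gap b (S.C z) := ⟨_, rfl⟩
  obtain ⟨v, hv⟩ : ∃ v, v = S.gap a (S.D z) - S.gap b (S.D z) := ⟨_, rfl⟩
  rw [Crosses, ← hu, ← hv] at hc
  obtain ⟨τ, hτ0, hτ1, hτ⟩ : ∃ τ : ℝ, 0 < τ ∧ τ < 1 ∧ (1 - τ) * u + τ * v = 0 := by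
    have huv : u - v ≠ 0 := by
      intro h0
      have : u = v := by linarith
      rw [this] at hc
      exact absurd hc (not_lt.2 (mul_self_nonneg v))
    refine ⟨u / (u - v), ?_, ?_, by field_simp; ring⟩
    · rcases mul_neg_iff.1 hc with ⟨h1, h2⟩ | ⟨h1, h2⟩
      · exact div_pos h1 (by linarith)
      · exact div_pos_of_neg_of_neg h1 (by linarith)
    · rcases mul_neg_iff.1 hc with ⟨h1, h2⟩ | ⟨h1, h2⟩
      · exact (div_lt_one (by linarith)).2 (by linarith)
      · exact (div_lt_one_of_neg (by linarith)).2 (by linarith)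
  obtain ⟨Z, hZ⟩ : ∃ Z, Z = (1 - τ) • S.C z + τ • S.D z := ⟨_, rfl⟩
  have hgap : ∀ j, S.gap j Z = (1 - τ) * S.gap j (S.C z) + τ * S.gap j (S.D z) := fun j => by
    rw [hZ, gap_combination]
  have hab : S.gap a Z = S.gap b Z := by
    rw [hgap, hgap]
    rw [hu, hv] at hτ
    linarith
  have hw : 0 < ((S.N b).1 - (S.N a).1) ^ 2 + ((S.N b).2 - (S.N a).2) ^ 2 := by
    by_contra hcon
    push Not at hcon
    have h1 : (S.N b).1 - (S.N a).1 = 0 :=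
      pow_eq_zero_iff two_ne_zero |>.1 (by
        linarith [sq_nonneg ((S.N b).1 - (S.N a).1), sq_nonneg ((S.N b).2 - (S.N a).2)])
    have h2 : (S.N b).2 - (S.N a).2 = 0 :=
      pow_eq_zero_iff two_ne_zero |>.1 (by
        linarith [sq_nonneg ((S.N b).1 - (S.N a).1), sq_nonneg ((S.N b).2 - (S.N a).2)])
    have h3 : S.N b = S.N a := Prod.ext (by linarith) (by linarith)
    have h4 := h.cr_as
    have h5 := h.cr_sb
    rw [h3, cr_swap] at h5
    linarith
  obtain ⟨t, ht⟩ : ∃ t, t = (((S.N b).1 - (S.N a).1) * (Z.2 - O.2) -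
      ((S.N b).2 - (S.N a).2) * (Z.1 - O.1)) /
      (((S.N b).1 - (S.N a).1) ^ 2 + ((S.N b).2 - (S.N a).2) ^ 2) := ⟨_, rfl⟩
  have hperp : ((S.N b).1 - (S.N a).1) * (Z.1 - O.1) + ((S.N b).2 - (S.N a).2) * (Z.2 - O.2)
      = 0 := by
    have h1 := h.gap_a.trans h.gap_b.symm
    simp only [gap, dt] at h1 hab
    linarith
  have hZO : Z = O + t • ((S.N a).2 - (S.N b).2, (S.N b).1 - (S.N a).1) := by
    rw [ht]
    ext
    · simp only [Prod.fst_add, Prod.smul_fst, smul_eq_mul]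
      field_simp
      linear_combination ((S.N b).1 - (S.N a).1) * hperp
    · simp only [Prod.snd_add, Prod.smul_snd, smul_eq_mul]
      field_simp
      linear_combination ((S.N b).2 - (S.N a).2) * hperp
  have hza' : S.gap a Z = r + t * cr (S.N a) (S.N b) := by
    rw [hZO, ← h.gap_a]
    simp only [gap, dt, cr, Prod.fst_add, Prod.snd_add, Prod.smul_fst, Prod.smul_snd, smul_eq_mul]
    ring
  have hzz' : S.gap z Z = S.gap z O - t * (cr (S.N b) (S.N z) + cr (S.N z) (S.N a)) := by
    rw [hZO]
    simp only [gap, dt, cr, Prod.fst_add, Prod.snd_add, Prod.smul_fst, Prod.smul_snd, smul_eq_mul]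
    ring
  rw [hgap, gap_C_self, gap_D_self] at hzz'
  have ha0 : 0 ≤ S.gap a Z := by
    rw [hgap]
    exact add_nonneg (mul_nonneg (by linarith) (S.gap_C_nonneg z a))
      (mul_nonneg hτ0.le (S.gap_D_nonneg z a))
  have hT := tri_pos_of_outside (S.unit a) (S.unit b) (S.unit z) h.cr_as h.cr_sb h.cr_ab
    (S.N_ne hza) (S.N_ne hzb) hzz
  rw [tri, add_assoc] at hT
  have hr := h.pos
  have hrz := h.le_gap z hz
  have ht0 : 0 < t := by
    by_contra hcon
    push Not at hcon
    have h1 := mul_nonneg_of_nonpos_of_nonpos hcon (neg_nonpos.2 hT.le)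
    have h2 : t * (cr (S.N b) (S.N z) + cr (S.N z) (S.N a)) = S.gap z O := by linarith
    have h3 : t * (cr (S.N a) (S.N b) + (cr (S.N b) (S.N z) + cr (S.N z) (S.N a))) = 0 := by
      linarith
    rcases mul_eq_zero.1 h3 with h4 | h4
    · rw [h4] at h2; linarith
    · linarith
  have hty : t * (cr (S.N b) (S.N z) + cr (S.N z) (S.N a)) = S.gap z O := by linarith
  refine ⟨t, τ, hτ0, hτ1, ht0, ?_, hty, fun j => by rw [← hZO, hgap]⟩
  exact (mul_pos_iff_of_pos_left ht0).1 (by linarith)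

lemma Crosses.unique {S : SegmentSystem ι} {F : Finset ι} {a s b z z' : ι} {O : ℝ × ℝ} {r : ℝ}
    (h : S.Touches F a s b O r) (hz : z ∈ F) (hza : z ≠ a) (hzb : z ≠ b)
    (hzz : 0 < cr (S.N b) (S.N z) ∨ 0 < cr (S.N z) (S.N a)) (hc : S.Crosses a b z)
    (hz' : z' ∈ F) (hza' : z' ≠ a) (hzb' : z' ≠ b)
    (hzz' : 0 < cr (S.N b) (S.N z') ∨ 0 < cr (S.N z') (S.N a)) (hc' : S.Crosses a b z') :
    z = z' := by
  obtain ⟨t, τ, hτ0, hτ1, -, hy, hty, hg⟩ := hc.exists_axis_point h hz hza hzb hzz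
  obtain ⟨t', τ', hτ0', hτ1', -, hy', hty', hg'⟩ := hc'.exists_axis_point h hz' hza' hzb' hzz'
  have aux : ∀ (x x' : ι) (t t' τ' : ℝ), 0 < τ' → τ' < 1 →
      0 < cr (S.N b) (S.N x) + cr (S.N x) (S.N a) →
      t * (cr (S.N b) (S.N x) + cr (S.N x) (S.N a)) = S.gap x O →
      S.gap x (O + t' • ((S.N a).2 - (S.N b).2, (S.N b).1 - (S.N a).1)) =
        (1 - τ') * S.gap x (S.C x') + τ' * S.gap x (S.D x') → t ≤ t' → x' = x := by
    intro x x' t t' τ' h0 h1 hy hty hg htt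
    have e : S.gap x (O + t' • ((S.N a).2 - (S.N b).2, (S.N b).1 - (S.N a).1)) =
        S.gap x O - t' * (cr (S.N b) (S.N x) + cr (S.N x) (S.N a)) := by
      simp only [gap, dt, cr, Prod.fst_add, Prod.snd_add, Prod.smul_fst, Prod.smul_snd,
        smul_eq_mul]
      ring
    have h2 := mul_le_mul_of_nonneg_right htt hy.le
    have hC := S.gap_C_nonneg x' x
    have hD := S.gap_D_nonneg x' x
    have h3 := mul_nonneg (sub_pos.2 h1).le hC
    have h4 := mul_nonneg h0.le hD
    have h5 : (1 - τ') * S.gap x (S.C x') = 0 := by linarith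
    have h6 : τ' * S.gap x (S.D x') = 0 := by linarith
    have h7 := (mul_eq_zero.1 h5).resolve_left (sub_pos.2 h1).ne'
    have h8 := (mul_eq_zero.1 h6).resolve_left h0.ne'
    by_contra hne
    exact S.strict x' x hne (sub_eq_zero.1 h7).symm (sub_eq_zero.1 h8).symm
  rcases le_total t t' with htt | htt
  · exact (aux z z' t t' τ' hτ0' hτ1' hy hty (hg' z) htt).symm
  · exact aux z' z t' t τ hτ0 hτ1 hy' hty' (hg z') htt

lemma Touches.apart_of_not_crosses {S : SegmentSystem ι} {F : Finset ι} {a s b z : ι} {O : ℝ × ℝ}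
    {r : ℝ} (h : S.Touches F a s b O r) (hz : z ∈ F)
    (hzz : 0 < cr (S.N b) (S.N z) ∨ 0 < cr (S.N z) (S.N a)) (hc : ¬S.Crosses a b z) :
    S.Apart s z := by
  intro X hX
  have hgap : ∀ j P, dt (S.N j) (P - O) = S.gap j O - S.gap j P := by
    intro j P
    simp only [gap, dt, Prod.fst_sub, Prod.snd_sub]
    ring
  have ga := h.gap_a
  have gs := h.gap_s
  have gb := h.gap_b
  have nC := S.gap_C_nonneg
  have nD := S.gap_D_nonneg
  rw [Crosses, not_lt, mul_nonneg_iff] at hc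
  rcases hc with ⟨h1, h2⟩ | ⟨h1, h2⟩
  · refine separated_of_above_axis (a := S.N a) (s := S.N s) (b := S.N b) (z := S.N z) (O := O)
      (P := S.C s) (Q := S.D s) (r := r) (d := S.gap z O) h.pos (S.unit a) (S.unit s) (S.unit b)
      (S.unit z) h.cr_as h.cr_sb h.cr_ab hzz (h.le_gap z hz) ?_ ?_ ?_ ?_ ?_ ?_ ?_ ?_ ?_ ?_ ?_ ?_ hX
      <;> rw [hgap]
    · rw [gap_C_self, sub_zero]
    · rw [gap_D_self, sub_zero]
    · linarith [nC z b]
    · linarith [nD z b]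
    · rw [hgap]; linarith
    · rw [hgap]; linarith
    · rw [gap_C_self]; linarith
    · rw [gap_D_self]; linarith
    · linarith [nC s b]
    · linarith [nD s b]
    · linarith [nC s a]
    · linarith [nD s a]
  · refine separated_of_below_axis (a := S.N a) (s := S.N s) (b := S.N b) (z := S.N z) (O := O)
      (P := S.C s) (Q := S.D s) (r := r) (d := S.gap z O) h.pos (S.unit a) (S.unit s) (S.unit b)
      (S.unit z) h.cr_as h.cr_sb h.cr_ab hzz (h.le_gap z hz) ?_ ?_ ?_ ?_ ?_ ?_ ?_ ?_ ?_ ?_ ?_ ?_ hX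
      <;> rw [hgap]
    · rw [gap_C_self, sub_zero]
    · rw [gap_D_self, sub_zero]
    · linarith [nC z a]
    · linarith [nD z a]
    · rw [hgap]; linarith
    · rw [hgap]; linarith
    · rw [gap_C_self]; linarith
    · rw [gap_D_self]; linarith
    · linarith [nC s b]
    · linarith [nD s b]
    · linarith [nC s a]
    · linarith [nD s a]

/-- Disks on segments in convex position form a 3-degenerate family. -/
lemma exists_few_neighbours [DecidableEq ι] {F : Finset ι} (hF : F.Nonempty) :
    ∃ s ∈ F, ∃ G : Finset ι, G.card ≤ 3 ∧ ∀ z ∈ F, z ≠ s → z ∉ G → S.Apart s z := by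
  classical
  rcases lt_or_ge F.card 4 with hF4 | hF4
  · obtain ⟨s, hs⟩ := hF
    exact ⟨s, hs, F, by omega, fun z hz _ hzF => absurd hz hzF⟩
  obtain ⟨a, s, b, O, r, h, hzz⟩ := S.exists_extremal_touches hF4
  let H := F.filter fun z => z ≠ a ∧ z ≠ s ∧ z ≠ b ∧ S.Crosses a b z
  have hH : H.card ≤ 1 := by
    refine Finset.card_le_one.2 fun x hx y hy => ?_
    obtain ⟨hxF, hxa, hxs, hxb, hxc⟩ := Finset.mem_filter.1 hx
    obtain ⟨hyF, hya, hys, hyb, hyc⟩ := Finset.mem_filter.1 hy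
    exact Crosses.unique h hxF hxa hxb (hzz x hxF hxa hxs hxb) hxc
      hyF hya hyb (hzz y hyF hya hys hyb) hyc
  refine ⟨s, h.mem_s, insert a (insert b H), ?_, fun z hz hzs hzG => ?_⟩
  · have h1 := Finset.card_insert_le a (insert b H)
    have h2 := Finset.card_insert_le b H
    omega
  · simp only [Finset.mem_insert, not_or] at hzG
    obtain ⟨hza, hzb, hzH⟩ := hzG
    refine h.apart_of_not_crosses hz (hzz z hz hza hzs hzb) fun hc => hzH ?_
    exact Finset.mem_filter.2 ⟨hz, hza, hzs, hzb, hc⟩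

lemma exists_pairwise_apart [DecidableEq ι] (F : Finset ι) :
    ∃ T ⊆ F, F.card ≤ 4 * T.card ∧ ∀ i ∈ T, ∀ j ∈ T, i ≠ j → S.Apart i j := by
  induction F using Finset.strongInduction with
  | H F ih =>
    rcases F.eq_empty_or_nonempty with rfl | hF
    · exact ⟨∅, Finset.Subset.refl _, by simp, by simp⟩
    obtain ⟨s, hs, G, hG, hsep⟩ := S.exists_few_neighbours hF
    have hsub : F \ insert s G ⊂ F :=
      ⟨Finset.sdiff_subset,
        fun h => (Finset.mem_sdiff.1 (h hs)).2 (Finset.mem_insert_self _ _)⟩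
    obtain ⟨T, hTF, hT, hpair⟩ := ih _ hsub
    have hmem : ∀ x ∈ T, x ∈ F ∧ x ≠ s ∧ x ∉ G := by
      intro x hx
      have := Finset.mem_sdiff.1 (hTF hx)
      simp only [Finset.mem_insert, not_or] at this
      exact this
    have hsT : s ∉ T := fun h => (hmem s h).2.1 rfl
    refine ⟨insert s T, ?_, ?_, ?_⟩
    · intro x hx
      rcases Finset.mem_insert.1 hx with rfl | hx
      · exact hs
      · exact (hmem x hx).1
    · rw [Finset.card_insert_of_notMem hsT]
      have h1 := Finset.card_insert_le s G
      have h2 := Finset.le_card_sdiff (insert s G) F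
      omega
    · intro i hi j hj hij
      rcases Finset.mem_insert.1 hi with hi' | hi' <;>
        rcases Finset.mem_insert.1 hj with hj' | hj'
      · exact absurd (hi'.trans hj'.symm) hij
      · obtain ⟨h1, h2, h3⟩ := hmem j hj'
        exact hi' ▸ hsep j h1 h2 h3
      · obtain ⟨h1, h2, h3⟩ := hmem i hi'
        exact hj' ▸ (hsep i h1 h2 h3).symm
      · exact hpair i hi' j hj' hij

end SegmentSystem

/-- The coordinates of a point of the Euclidean plane. -/
def coords (x : E2) : ℝ × ℝ := (x 0, x 1)

lemma mem_sideDisk_iff (p q x : E2) :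
    x ∈ sideDisk p q ↔ dt (coords x - coords p) (coords x - coords q) ≤ 0 := by
  have h1 : x ∈ sideDisk p q ↔ dist x (midpoint ℝ p q) ^ 2 ≤ (dist p q / 2) ^ 2 := by
    rw [sideDisk, Metric.mem_closedBall, pow_le_pow_iff_left₀ dist_nonneg (by positivity)
      two_ne_zero]
  have hm : ∀ k, (midpoint ℝ p q) k = (p k + q k) / 2 := by
    intro k
    simp [midpoint_eq_smul_add]
    ring
  rw [h1, div_pow, EuclideanSpace.dist_sq_eq, EuclideanSpace.dist_sq_eq]
  simp only [Fin.sum_univ_two, Real.dist_eq, sq_abs, hm, dt, coords, Prod.fst_sub, Prod.snd_sub]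
  constructor <;> intro h <;> nlinarith

/-- The orientation determinant of three points. -/
def orient (a b c : ℝ × ℝ) : ℝ := cr (b - a) (c - a)

lemma ccw_iff (a b c : E2) : Ccw a b c ↔ 0 < orient (coords a) (coords b) (coords c) := Iff.rfl

lemma orient_rotate (a b c : ℝ × ℝ) : orient a b c = orient b c a := by
  simp only [orient, cr, Prod.fst_sub, Prod.snd_sub]
  ring

lemma orient_left (a b : ℝ × ℝ) : orient a b a = 0 := by simp [orient, cr]

lemma orient_right (a b : ℝ × ℝ) : orient a b b = 0 := cr_self _

lemma nxt_val {n : ℕ} (i : Fin n) :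
    ((i : ℕ) + 1 < n ∧ (nxt i : ℕ) = i + 1) ∨ ((i : ℕ) + 1 = n ∧ (nxt i : ℕ) = 0) := by
  have hi := i.isLt
  rcases Nat.lt_or_ge ((i : ℕ) + 1) n with h | h
  · exact Or.inl ⟨h, Nat.mod_eq_of_lt h⟩
  · have h' : (i : ℕ) + 1 = n := by omega
    exact Or.inr ⟨h', by simp [nxt, h']⟩

lemma IsConvexPolygon.orient_pos {n : ℕ} {p : Fin n → E2} (hp : IsConvexPolygon p)
    {j k : Fin n} (h1 : k ≠ j) (h2 : k ≠ nxt j) :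
    0 < orient (coords (p j)) (coords (p (nxt j))) (coords (p k)) := by
  rw [Ne, Fin.ext_iff] at h1 h2
  have hk := k.isLt
  rcases nxt_val j with ⟨hj, hj'⟩ | ⟨hj, hj'⟩
  · rcases Nat.lt_or_ge k j with h | h
    · rw [orient_rotate, orient_rotate, ← ccw_iff]
      exact hp _ _ _ (Fin.lt_def.2 h) (Fin.lt_def.2 (by omega))
    · rw [← ccw_iff]
      exact hp _ _ _ (Fin.lt_def.2 (by omega)) (Fin.lt_def.2 (by omega))
  · rw [orient_rotate, ← ccw_iff]
    exact hp _ _ _ (Fin.lt_def.2 (by omega)) (Fin.lt_def.2 (by omega))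

lemma IsConvexPolygon.orient_nonneg {n : ℕ} {p : Fin n → E2} (hp : IsConvexPolygon p)
    (j k : Fin n) : 0 ≤ orient (coords (p j)) (coords (p (nxt j))) (coords (p k)) := by
  by_cases h1 : k = j
  · rw [h1, orient_left]
  by_cases h2 : k = nxt j
  · rw [h2, orient_right]
  exact (hp.orient_pos h1 h2).le

lemma IsConvexPolygon.coords_ne {n : ℕ} (hn : 3 ≤ n) {p : Fin n → E2} (hp : IsConvexPolygon p)
    (j : Fin n) : coords (p j) ≠ coords (p (nxt j)) := by
  intro h
  obtain ⟨k, hk⟩ : ∃ k, k ∉ ({j, nxt j} : Finset (Fin n)) := by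
    by_contra! hcon
    have h1 := Finset.card_le_card (fun x _ => hcon x : Finset.univ ⊆ {j, nxt j})
    have h2 : ({j, nxt j} : Finset (Fin n)).card ≤ 2 := Finset.card_le_two
    rw [Finset.card_univ, Fintype.card_fin] at h1
    omega
  simp only [Finset.mem_insert, Finset.mem_singleton, not_or] at hk
  have := hp.orient_pos hk.1 hk.2
  rw [← h] at this
  simp [orient, cr] at this

/-- The outer unit normal of an oriented segment. -/
def outerNormal (a b : ℝ × ℝ) : ℝ × ℝ :=
  (√(dt (b - a) (b - a)))⁻¹ • ((b - a).2, -(b - a).1)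

lemma dt_self_pos {a b : ℝ × ℝ} (h : a ≠ b) : 0 < dt (b - a) (b - a) := by
  by_contra! hcon
  simp only [dt, Prod.fst_sub, Prod.snd_sub] at hcon
  apply h
  ext <;> nlinarith [sq_nonneg (b.1 - a.1), sq_nonneg (b.2 - a.2)]

lemma dt_outerNormal_self {a b : ℝ × ℝ} (h : a ≠ b) :
    dt (outerNormal a b) (outerNormal a b) = 1 := by
  have h0 := dt_self_pos h
  have h1 := Real.sq_sqrt h0.le
  have h2 := (Real.sqrt_pos.2 h0).ne'
  unfold outerNormal
  set l := √(dt (b - a) (b - a))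
  simp only [dt, Prod.smul_fst, Prod.smul_snd, smul_eq_mul] at h1 ⊢
  field_simp
  linear_combination -h1

lemma dt_outerNormal (a b x : ℝ × ℝ) :
    dt (outerNormal a b) x =
      dt (outerNormal a b) a - (√(dt (b - a) (b - a)))⁻¹ * orient a b x := by
  unfold outerNormal
  generalize (√(dt (b - a) (b - a)))⁻¹ = l
  simp only [dt, orient, cr, Prod.smul_fst, Prod.smul_snd, Prod.fst_sub, Prod.snd_sub, smul_eq_mul]
  ring

lemma dt_outerNormal_le {a b x : ℝ × ℝ} (h : 0 ≤ orient a b x) :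
    dt (outerNormal a b) x ≤ dt (outerNormal a b) a := by
  rw [dt_outerNormal a b x]
  have := mul_nonneg (inv_nonneg.2 (Real.sqrt_nonneg (dt (b - a) (b - a)))) h
  linarith

lemma dt_outerNormal_eq_iff {a b x : ℝ × ℝ} (hab : a ≠ b) :
    dt (outerNormal a b) x = dt (outerNormal a b) a ↔ orient a b x = 0 := by
  rw [dt_outerNormal a b x]
  have := (inv_pos.2 (Real.sqrt_pos.2 (dt_self_pos hab))).ne'
  simp [this]

/-- The sides of a convex polygon form a segment system. -/
def IsConvexPolygon.segmentSystem {n : ℕ} (hn : 3 ≤ n) {p : Fin n → E2}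
    (hp : IsConvexPolygon p) : SegmentSystem (Fin n) where
  N i := outerNormal (coords (p i)) (coords (p (nxt i)))
  h i := dt (outerNormal (coords (p i)) (coords (p (nxt i)))) (coords (p i))
  C i := coords (p i)
  D i := coords (p (nxt i))
  unit i := dt_outerNormal_self (hp.coords_ne hn i)
  dt_C _ := rfl
  dt_D i := (dt_outerNormal_eq_iff (hp.coords_ne hn i)).2 (orient_right _ _)
  le_C i j := dt_outerNormal_le (hp.orient_nonneg j i)
  le_D i j := dt_outerNormal_le (hp.orient_nonneg j (nxt i))
  ne i := hp.coords_ne hn i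
  strict i j hij hC hD := by
    rw [dt_outerNormal_eq_iff (hp.coords_ne hn j)] at hC hD
    have h1 : i = nxt j := by
      by_contra h
      exact (hp.orient_pos hij h).ne' hC
    have h2 : nxt i = j := by
      by_contra h
      refine (hp.orient_pos h fun h' => ?_).ne' hD
      have := hp.coords_ne hn i
      rw [h', ← h1] at this
      exact this rfl
    have h3 := nxt_val i
    have h4 := nxt_val j
    rw [← h1] at h4
    rw [h2] at h3
    omega

/-- For every convex polygon of `n ≥ 3` sides, one can select at least `⌈n/4⌉`
pairwise disjoint side disks. -/
theorem exists_indep_set_ge (n : ℕ) (hn : 3 ≤ n) (p : Fin n → E2)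
    (hconv : IsConvexPolygon p) :
    ∃ S : Finset (Fin n), (n + 3) / 4 ≤ S.card ∧
      ∀ i ∈ S, ∀ j ∈ S, i ≠ j → polyDisk p i ∩ polyDisk p j = ∅ := by
  obtain ⟨T, -, hT, hpair⟩ := (hconv.segmentSystem hn).exists_pairwise_apart Finset.univ
  rw [Finset.card_univ, Fintype.card_fin] at hT
  refine ⟨T, by omega, fun i hi j hj hij => ?_⟩
  rw [Set.eq_empty_iff_forall_notMem]
  rintro x ⟨hxi, hxj⟩
  rw [polyDisk, mem_sideDisk_iff] at hxi hxj
  exact absurd (hpair i hi j hj hij (coords x) hxi) (not_lt.2 hxj)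
end
end
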